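/- arXiv:2402.15387 — 4 statements merged into one kernel-verified Lean document; each statement's English description precedes it below -/
import Mathlib

section
/- Let p ∈ [1,∞) and let q be the conjugate exponent (1/p + 1/q = 1, with q = ∞ when p = 1). For every Y ∈ L^p(Ω, Σ, P) and every β ∈ [0,1), the higher order risk measure associated with the L^p-norm admits the dual representation inf_{t ∈ ℝ} ( t + (1−β)^{-1}·(E[((Y−t)₊)^p])^{1/p} ) = sup{ E[Y·Z] : Z ∈ L^q(P), Z ≥ 0 almost surely, E[Z] = 1, ‖Z‖_q ≤ (1−β)^{-1} }. -/
open MeasureTheory Set ENNReal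

theorem hb_aux {E : Type*} [NormedAddCommGroup E] [Lattice E] [HasSolidNorm E]
    [IsOrderedAddMonoid E] [NormedSpace ℝ E] (e : E) (he : ‖e‖ = 1) (he0 : 0 ≤ e)
    (hsm : ∀ (k : ℝ) (x : E), 0 < k → ‖(k • x)⁺‖ = k * ‖x⁺‖) (c : ℝ) (hc : 1 ≤ c) (y : E) :
    ∃ G : E →L[ℝ] ℝ, (∀ x, 0 ≤ x → 0 ≤ G x) ∧ (∀ x, G x ≤ c * ‖x‖) ∧ G e = 1 ∧
      G y = ⨅ t : ℝ, t + c * ‖(y - t • e)⁺‖ := by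
  set N : E → ℝ := fun x => ⨅ t : ℝ, t + c * ‖(x - t • e)⁺‖ with hN
  have hpn : ∀ x : E, ‖x⁺‖ ≤ ‖x‖ := fun x => by
    apply norm_le_norm_of_abs_le_abs
    rw [abs_of_nonneg (posPart_nonneg x)]
    exact sup_le (le_abs_self x) (abs_nonneg x)
  have hmono : ∀ x z : E, 0 ≤ x → x ≤ z → ‖x‖ ≤ ‖z‖ := fun x z h h' => by
    apply norm_le_norm_of_abs_le_abs
    rwa [abs_of_nonneg h, abs_of_nonneg (h.trans h')]
  have hadd : ∀ x z : E, ‖(x + z)⁺‖ ≤ ‖x⁺‖ + ‖z⁺‖ := fun x z =>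
    (hmono _ _ (posPart_nonneg _) (sup_le (add_le_add (le_posPart x) (le_posPart z))
      (add_nonneg (posPart_nonneg x) (posPart_nonneg z)))).trans (norm_add_le _ _)
  have hbd : ∀ x : E, BddBelow (range fun t : ℝ => t + c * ‖(x - t • e)⁺‖) := by
    intro x
    refine ⟨-(c * ‖x‖), ?_⟩
    rintro _ ⟨t, rfl⟩
    have c0 : 0 ≤ c := by linarith
    have n1 := mul_nonneg c0 (norm_nonneg (x - t • e)⁺)
    have n2 := mul_nonneg c0 (norm_nonneg x)
    rcases le_or_gt 0 t with ht | ht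
    · change _ ≤ t + c * ‖(x - t • e)⁺‖
      linarith
    · have h1 := hadd (x - t • e) (-x)
      have e1 : x - t • e + -x = (-t) • e := by rw [neg_smul]; abel
      rw [e1, hsm (-t) e (by linarith), posPart_of_nonneg he0, he] at h1
      have h2 := hpn (-x)
      rw [norm_neg] at h2
      change _ ≤ t + c * ‖(x - t • e)⁺‖
      nlinarith
  have hle : ∀ x t, N x ≤ t + c * ‖(x - t • e)⁺‖ := fun x t => ciInf_le (hbd x) t
  have N_hom : ∀ k : ℝ, 0 < k → ∀ x, N (k • x) = k * N x := by
    have h1 : ∀ k : ℝ, 0 < k → ∀ x, N (k • x) ≤ k * N x := by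
      intro k hk x
      rw [← div_le_iff₀' hk]
      refine le_ciInf fun t => ?_
      rw [div_le_iff₀' hk]
      refine (hle _ (k * t)).trans (le_of_eq ?_)
      rw [mul_smul, ← smul_sub, hsm k _ hk]; ring
    intro k hk x
    refine le_antisymm (h1 k hk x) ?_
    have := h1 k⁻¹ (inv_pos.2 hk) (k • x)
    rw [smul_smul, inv_mul_cancel₀ hk.ne', one_smul] at this
    rwa [← le_inv_mul_iff₀ hk]
  have N_add : ∀ x z, N (x + z) ≤ N x + N z := by
    intro x z
    rw [← sub_le_iff_le_add']
    refine le_ciInf fun t => ?_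
    rw [sub_le_comm]
    refine le_ciInf fun s => ?_
    have h1 := hle (x + z) (s + t)
    have h2 := hadd (x - s • e) (z - t • e)
    have e1 : x + z - (s + t) • e = (x - s • e) + (z - t • e) := by rw [add_smul]; abel
    rw [e1] at h1
    have h3 := mul_le_mul_of_nonneg_left h2 (by linarith : (0:ℝ) ≤ c)
    linarith
  have N_0 : N 0 = 0 := by
    have := N_hom 2 (by norm_num) 0
    rw [smul_zero] at this; linarith
  let f : E →ₗ.[ℝ] ℝ := LinearPMap.mkSpanSingleton' y (N y) (by
    intro k hk
    rcases eq_or_ne k 0 with rfl | h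
    · simp
    · have : y = 0 := by simpa [h] using hk
      rw [this, N_0, smul_zero])
  obtain ⟨g, hg1, hg2⟩ := exists_extension_of_le_sublinear f N N_hom N_add (by
    rintro ⟨x, hx⟩
    obtain ⟨k, rfl⟩ := Submodule.mem_span_singleton.1 hx
    change f _ ≤ N (k • y)
    rw [LinearPMap.mkSpanSingleton'_apply, smul_eq_mul, RingHom.id_apply]
    rcases lt_trichotomy k 0 with h | rfl | h
    · have h1 := N_add (k • y) ((-k) • y)
      rw [← add_smul, add_neg_cancel, zero_smul, N_0, N_hom (-k) (by linarith)] at h1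
      linarith
    · simp [N_0]
    · rw [N_hom k h])
  have hgb : ∀ x, g x ≤ c * ‖x‖ := fun x => by
    have h1 := (hg2 x).trans (hle x 0)
    have h2 := mul_le_mul_of_nonneg_left (hpn x) (by linarith : (0:ℝ) ≤ c)
    simp at h1
    linarith
  refine ⟨g.mkContinuous c (fun x => ?_), ?_, ?_, ?_, ?_⟩
  · rw [Real.norm_eq_abs, abs_le']
    refine ⟨hgb x, ?_⟩
    have := hgb (-x)
    simpa using this
  · intro x hx
    have h1 := (hg2 (-x)).trans (hle (-x) 0)
    have h2 : (-x)⁺ = 0 := by simpa using hx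
    simp [h2] at h1
    simpa using h1
  · exact hgb
  · have h1 := (hg2 e).trans (hle e 1)
    have h2 := (hg2 (-e)).trans (hle (-e) (-1))
    simp at h1 h2
    change g e = 1
    linarith
  · have := hg1 ⟨y, Submodule.mem_span_singleton_self y⟩
    change g y = N y
    refine this.trans ?_
    exact LinearPMap.mkSpanSingleton'_apply_self ..

theorem rn_aux {Ω : Type*} [MeasurableSpace Ω] (P : Measure Ω) [IsProbabilityMeasure P]
    (p : ℝ≥0∞) [Fact (1 ≤ p)] (hp' : p ≠ ∞) (G : Lp ℝ p P →L[ℝ] ℝ) :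
    ∃ Z : Ω → ℝ, Measurable Z ∧ Integrable Z P ∧
      ∀ (s : Set Ω) (hs : MeasurableSet s),
        G (indicatorConstLp p hs (measure_ne_top P s) (1:ℝ)) = ∫ ω in s, Z ω ∂P := by
  classical
  let m : SignedMeasure Ω :=
    { measureOf' := fun s => if hs : MeasurableSet s then
        G (indicatorConstLp p hs (measure_ne_top P s) (1:ℝ)) else 0
      empty' := by simp
      not_measurable' := fun s hs => dif_neg hs
      m_iUnion' := by
        intro f hf hd
        simp only [hf, MeasurableSet.iUnion hf, dif_pos]
        refine HasSum.mapL (φ := G) ?_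
        have hfin : ∀ S : Finset ℕ, MeasurableSet (⋃ i ∈ S, f i) :=
          fun S => Finset.measurableSet_biUnion S fun i _ => hf i
        have key : ∀ S : Finset ℕ,
            ∑ i ∈ S, indicatorConstLp p (hf i) (measure_ne_top P (f i)) (1:ℝ) =
            indicatorConstLp p (hfin S) (measure_ne_top P _) (1:ℝ) := by
          intro S
          induction S using Finset.induction_on with
          | empty => simp
          | insert a S ha ih =>
            rw [Finset.sum_insert ha, ih, ← indicatorConstLp_disjoint_union]
            · congr 1
              simp
            · rw [Set.disjoint_iUnion₂_right]
              intro i hi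
              exact hd (by rintro rfl; exact ha hi)
        rw [HasSum]
        simp only [key]
        refine tendsto_indicatorConstLp_set hp' ?_
        have h1 : ∀ S : Finset ℕ, P (symmDiff (⋃ i ∈ S, f i) (⋃ i, f i)) = P (⋃ i, f i) - ∑ i ∈ S, P (f i) := by
          intro S
          have hsub : (⋃ i ∈ S, f i) ⊆ ⋃ i, f i := iUnion₂_subset_iUnion _ _
          rw [symmDiff_of_le hsub, measure_sdiff hsub (hfin S).nullMeasurableSet (measure_ne_top _ _),
            measure_biUnion_finset (fun i _ j _ h => hd h) (fun i _ => hf i)]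
        simp only [SummationFilter.unconditional_filter, h1]
        have h2 : HasSum (fun i => P (f i)) (P (⋃ i, f i)) := by
          rw [measure_iUnion hd hf]; exact ENNReal.summable.hasSum
        have h3 := ENNReal.Tendsto.sub (tendsto_const_nhds (x := P (⋃ i, f i))) h2
          (Or.inl (measure_ne_top _ _))
        simpa using h3 }
  have hm : ∀ s (hs : MeasurableSet s), m s = G (indicatorConstLp p hs (measure_ne_top P s) (1:ℝ)) :=
    fun s hs => dif_pos hs
  have hac : m ≪ᵥ P.toENNRealVectorMeasure := by
    refine VectorMeasure.AbsolutelyContinuous.mk fun s hs h0 => ?_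
    rw [Measure.toENNRealVectorMeasure_apply_measurable hs] at h0
    rw [hm s hs]
    have : indicatorConstLp p hs (measure_ne_top P s) (1:ℝ) = 0 := by
      rw [← norm_eq_zero, norm_indicatorConstLp (zero_lt_one.trans_le Fact.out).ne' hp']
      have : p.toReal ≠ 0 := ENNReal.toReal_ne_zero.2 ⟨(zero_lt_one.trans_le Fact.out).ne', hp'⟩
      simp [Measure.real, h0, this]
    rw [this, map_zero]
  have hrn := (SignedMeasure.absolutelyContinuous_iff_withDensityᵥ_rnDeriv_eq m P).1 hac
  refine ⟨m.rnDeriv P, SignedMeasure.measurable_rnDeriv _ _, SignedMeasure.integrable_rnDeriv _ _, ?_⟩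
  intro s hs
  rw [← hm s hs]
  conv_lhs => rw [← hrn]
  exact withDensityᵥ_apply (SignedMeasure.integrable_rnDeriv _ _) hs

theorem simple_aux {Ω : Type*} [MeasurableSpace Ω] (P : Measure Ω) [IsProbabilityMeasure P]
    (p : ℝ≥0∞) [Fact (1 ≤ p)] (G : Lp ℝ p P →L[ℝ] ℝ) (Z : Ω → ℝ) (hZ : Integrable Z P)
    (h : ∀ (s : Set Ω) (hs : MeasurableSet s),
        G (indicatorConstLp p hs (measure_ne_top P s) (1:ℝ)) = ∫ ω in s, Z ω ∂P)
    (f : SimpleFunc Ω ℝ) : ∀ hf : MemLp f p P, G (hf.toLp f) = ∫ ω, f ω * Z ω ∂P := by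
  induction f using SimpleFunc.induction with
  | const c hs =>
    rename_i s
    intro hf
    have e1 : hf.toLp _ = c • indicatorConstLp p hs (measure_ne_top P s) (1:ℝ) := by
      rw [indicatorConstLp, ← MemLp.toLp_const_smul]
      apply MemLp.toLp_congr
      refine Filter.Eventually.of_forall fun x => ?_
      by_cases hx : x ∈ s <;> simp [hx]
    rw [e1, map_smul, h, smul_eq_mul, ← integral_const_mul, ← integral_indicator hs]
    congr 1
    ext x
    by_cases hx : x ∈ s <;> simp [hx]
  | add hd hf hg =>
    rename_i f g
    intro hfg
    have mf : MemLp f p P := SimpleFunc.memLp_of_isFiniteMeasure f p P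
    have mg : MemLp g p P := SimpleFunc.memLp_of_isFiniteMeasure g p P
    have : hfg.toLp _ = mf.toLp f + mg.toLp g := by
      rw [← MemLp.toLp_add]; rfl
    rw [this, map_add, hf mf, hg mg, ← integral_add]
    · congr 1; ext x; simp [add_mul]
    · have := SimpleFunc.memLp_of_isFiniteMeasure f ∞ P
      exact hZ.mul_of_top_right this
    · have := SimpleFunc.memLp_of_isFiniteMeasure g ∞ P
      exact hZ.mul_of_top_right this

theorem bound_aux {Ω : Type*} [MeasurableSpace Ω] (P : Measure Ω) [IsProbabilityMeasure P]
    (p q : ℝ≥0∞) [Fact (1 ≤ p)] (hp' : p ≠ ∞) (hpq : p⁻¹ + q⁻¹ = 1) (c : ℝ) (hc : 1 ≤ c)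
    (G : Lp ℝ p P →L[ℝ] ℝ) (hG : ∀ X, G X ≤ c * ‖X‖) (Z : Ω → ℝ) (hZm : Measurable Z)
    (hZ : Integrable Z P) (hZ0 : ∀ᵐ ω ∂P, 0 ≤ Z ω)
    (h : ∀ (s : Set Ω) (hs : MeasurableSet s),
        G (indicatorConstLp p hs (measure_ne_top P s) (1:ℝ)) = ∫ ω in s, Z ω ∂P) :
    eLpNorm Z q P ≤ ENNReal.ofReal c := by
  have hp0 : p ≠ 0 := (zero_lt_one.trans_le Fact.out).ne'
  rcases eq_or_ne q ∞ with rfl | hq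
  · have hp1 : p = 1 := by simpa using hpq
    subst hp1
    rw [eLpNorm_exponent_top]
    have : Z ≤ᵐ[P] fun _ => c := by
      refine ae_le_of_forall_setIntegral_le hZ (integrable_const c) fun s hs _ => ?_
      rw [← h s hs]
      refine (hG _).trans (le_of_eq ?_)
      rw [norm_indicatorConstLp one_ne_zero one_ne_top]
      simp [mul_comm]
    refine eLpNormEssSup_le_of_ae_bound ?_
    filter_upwards [this, hZ0] with x h1 h2
    rwa [Real.norm_eq_abs, abs_of_nonneg h2]
  have hpq' : p.toReal.HolderConjugate q.toReal := by
    have : p.HolderConjugate q := ⟨by simpa using hpq⟩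
    exact ENNReal.HolderConjugate.toReal_of_ne_top hp' hq
  have hq0 : q ≠ 0 := by rintro rfl; simp at hpq
  set a := p.toReal
  set b := q.toReal
  have hs : ∀ s : SimpleFunc Ω ℝ, (∀ ω, 0 ≤ s ω) → (∀ᵐ ω ∂P, s ω ≤ Z ω) →
      eLpNorm s q P ≤ ENNReal.ofReal c := by
    intro s hs0 hsZ
    have ms := SimpleFunc.memLp_of_isFiniteMeasure s q P
    let u : SimpleFunc Ω ℝ := s.map (fun x => x ^ (b - 1))
    have hu : ∀ ω, u ω = s ω ^ (b - 1) := fun ω => rfl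
    have mu := SimpleFunc.memLp_of_isFiniteMeasure u p P
    have h1 := simple_aux P p G Z hZ h u mu
    have h2 := hG (mu.toLp u)
    rw [h1, Lp.norm_toLp, mu.eLpNorm_eq_integral_rpow_norm hp0 hp',
      ENNReal.toReal_ofReal (by positivity)] at h2
    set A := ∫ ω, s ω ^ b ∂P with hA
    have hA0 : 0 ≤ A := integral_nonneg fun ω => Real.rpow_nonneg (hs0 ω) _
    have h3 : ∫ ω, ‖u ω‖ ^ a ∂P = A := by
      congr 1
      ext ω
      rw [hu, Real.norm_of_nonneg (Real.rpow_nonneg (hs0 ω) _), ← Real.rpow_mul (hs0 ω)]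
      congr 1
      exact hpq'.symm.sub_one_mul_conj
    have h4 : A ≤ ∫ ω, u ω * Z ω ∂P := by
      refine integral_mono_ae ?_ ?_ ?_
      · exact (SimpleFunc.integrable_of_isFiniteMeasure (s.map (fun x => x ^ b)))
      · exact hZ.mul_of_top_right (SimpleFunc.memLp_of_isFiniteMeasure u ∞ P)
      · filter_upwards [hsZ] with ω hω
        calc s ω ^ b = s ω ^ (b - 1) * s ω := by
              rw [← Real.rpow_add_one' (hs0 ω) (by simpa using hpq'.symm.ne_zero)]; simp
          _ ≤ _ := by
              rw [hu]
              exact mul_le_mul_of_nonneg_left hω (Real.rpow_nonneg (hs0 ω) _)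
    change _ ≤ c * (∫ ω, ‖u ω‖ ^ a ∂P) ^ a⁻¹ at h2
    rw [h3] at h2
    rw [ms.eLpNorm_eq_integral_rpow_norm hq0 hq]
    apply ENNReal.ofReal_le_ofReal
    have h5 : ∫ ω, ‖s ω‖ ^ q.toReal ∂P = A := by
      simp only [Real.norm_of_nonneg (hs0 _)]; rfl
    rw [h5]
    change A ^ b⁻¹ ≤ c
    rcases hA0.eq_or_lt with h0 | h0
    · rw [← h0, Real.zero_rpow (inv_ne_zero hpq'.symm.ne_zero)]; linarith
    · have h6 : A ^ b⁻¹ * A ^ a⁻¹ = A := by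
        rw [← Real.rpow_add h0, add_comm, hpq'.inv_add_inv_eq_one, Real.rpow_one]
      have h7 : 0 < A ^ a⁻¹ := Real.rpow_pos_of_pos h0 _
      refine le_of_mul_le_mul_right ?_ h7
      rw [h6]
      exact h4.trans h2
  let F : Ω → ℝ≥0∞ := fun ω => ENNReal.ofReal (Z ω)
  have hF : Measurable F := hZm.ennreal_ofReal
  let s : ℕ → SimpleFunc Ω ℝ := fun n => (SimpleFunc.eapprox F n).map ENNReal.toReal
  have hlim : ∀ᵐ ω ∂P, Filter.Tendsto (fun n => s n ω) Filter.atTop (nhds (Z ω)) := by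
    filter_upwards [hZ0] with ω hω
    have h1 := SimpleFunc.tendsto_eapprox hF ω
    have h2 := (ENNReal.tendsto_toReal (ENNReal.ofReal_ne_top (r := Z ω))).comp h1
    rw [ENNReal.toReal_ofReal hω] at h2
    exact h2
  refine (Lp.eLpNorm_lim_le_liminf_eLpNorm (fun n => (s n).aestronglyMeasurable) Z hlim).trans ?_
  refine Filter.liminf_le_of_le (by isBoundedDefault) (fun d hd => ?_)
  obtain ⟨n, hn⟩ := hd.exists
  refine hn.trans (hs (s n) (fun ω => ENNReal.toReal_nonneg) ?_)
  filter_upwards [hZ0] with ω hω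
  refine ENNReal.toReal_le_of_le_ofReal hω ?_
  calc _ ≤ ⨆ n, SimpleFunc.eapprox F n ω := le_iSup (fun n => SimpleFunc.eapprox F n ω) n
    _ = F ω := SimpleFunc.iSup_eapprox_apply hF ω

theorem rep_aux {Ω : Type*} [MeasurableSpace Ω] (P : Measure Ω) [IsProbabilityMeasure P]
    (p q : ℝ≥0∞) [Fact (1 ≤ p)] (hp' : p ≠ ∞) (hpq : p⁻¹ + q⁻¹ = 1) (c : ℝ) (hc : 1 ≤ c)
    (G : Lp ℝ p P →L[ℝ] ℝ) (hG : ∀ X, G X ≤ c * ‖X‖) (hG0 : ∀ X, 0 ≤ X → 0 ≤ G X) :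
    ∃ Z : Ω → ℝ, MemLp Z q P ∧ (∀ᵐ ω ∂P, 0 ≤ Z ω) ∧ eLpNorm Z q P ≤ ENNReal.ofReal c ∧
      ∀ X : Lp ℝ p P, G X = ∫ ω, X ω * Z ω ∂P := by
  obtain ⟨Z, hZm, hZ, h⟩ := rn_aux P p hp' G
  have hZ0 : ∀ᵐ ω ∂P, 0 ≤ Z ω := by
    refine ae_nonneg_of_forall_setIntegral_nonneg hZ fun s hs _ => ?_
    rw [← h s hs]
    apply hG0
    rw [← Lp.coeFn_nonneg]
    filter_upwards [indicatorConstLp_coeFn (p := p) (hs := hs) (hμs := measure_ne_top P s) (c := (1:ℝ))] with x hx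
    rw [hx]
    exact indicator_nonneg (fun _ _ => zero_le_one) _
  have hb := bound_aux P p q hp' hpq c hc G hG Z hZm hZ hZ0 h
  have hmem : MemLp Z q P := ⟨hZm.aestronglyMeasurable, hb.trans_lt ENNReal.ofReal_lt_top⟩
  refine ⟨Z, hmem, hZ0, hb, ?_⟩
  have : p.HolderConjugate q := ⟨by simpa using hpq⟩
  have : Fact (1 ≤ q) := ⟨ENNReal.HolderConjugate.one_le q p⟩
  let B : Lp ℝ p P →L[ℝ] Lp ℝ q P →L[ℝ] ℝ := (ContinuousLinearMap.mul ℝ ℝ).lpPairing P p q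
  have hB : ∀ X : Lp ℝ p P, B X (hmem.toLp Z) = ∫ ω, X ω * Z ω ∂P := by
    intro X
    rw [ContinuousLinearMap.lpPairing_eq_integral]
    apply integral_congr_ae
    filter_upwards [hmem.coeFn_toLp] with x hx
    simp [hx]
  intro X
  rw [← hB]
  refine (Lp.simpleFunc.denseRange hp').induction_on (p := fun X : Lp ℝ p P => G X = B X (hmem.toLp Z)) X ?_ ?_
  · exact isClosed_eq G.continuous (B.flip (hmem.toLp Z)).continuous
  · intro f
    rw [hB]
    have e1 := simple_aux P p G Z hZ h (Lp.simpleFunc.toSimpleFunc f) (Lp.simpleFunc.memLp f)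
    have e2 : (Lp.simpleFunc.memLp f).toLp _ = (f : Lp ℝ p P) :=
      congrArg Subtype.val (Lp.simpleFunc.toLp_toSimpleFunc f)
    rw [e2] at e1
    rw [e1]
    apply integral_congr_ae
    filter_upwards [Lp.simpleFunc.toSimpleFunc_eq_toFun f] with x hx
    rw [hx]

theorem holder_aux {Ω : Type*} [MeasurableSpace Ω] (P : Measure Ω) [IsProbabilityMeasure P]
    (p q : ℝ≥0∞) (hconj : p.HolderConjugate q) (c : ℝ) (hc : 0 ≤ c) (X : Lp ℝ p P)
    (Z : Ω → ℝ) (hZ : MemLp Z q P) (hZc : eLpNorm Z q P ≤ ENNReal.ofReal c) :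
    ∫ ω, X ω * Z ω ∂P ≤ c * ‖X‖ := by
  have h4 : eLpNorm ((X : Ω → ℝ) • Z) 1 P ≤ eLpNorm X p P * eLpNorm Z q P :=
    eLpNorm_smul_le_mul_eLpNorm hZ.1 (Lp.memLp X).1
  have h5 : ENNReal.ofReal (∫ ω, X ω * Z ω ∂P) ≤ eLpNorm ((X : Ω → ℝ) • Z) 1 P := by
    rw [eLpNorm_one_eq_lintegral_enorm]
    refine le_trans ?_ (enorm_integral_le_lintegral_enorm _)
    exact Real.ofReal_le_enorm _
  have h6 := (h5.trans h4).trans (mul_le_mul_right hZc (eLpNorm X p P))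
  have h7 : eLpNorm X p P = ENNReal.ofReal ‖X‖ := by
    rw [Lp.norm_def, ENNReal.ofReal_toReal (Lp.eLpNorm_ne_top X)]
  rw [h7, ← ENNReal.ofReal_mul (by rw [Lp.norm_def]; positivity)] at h6
  rw [mul_comm c]
  have h8 : 0 ≤ ‖X‖ * c := by rw [Lp.norm_def]; positivity
  exact (ENNReal.ofReal_le_ofReal_iff h8).1 h6

set_option maxHeartbeats 1000000 in
theorem stmt2 {Ω : Type*} [MeasurableSpace Ω] (P : Measure Ω) [IsProbabilityMeasure P]
    (p q : ℝ≥0∞) (hp : 1 ≤ p) (hp' : p ≠ ∞) (hpq : 1 / p + 1 / q = 1)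
    (Y : Ω → ℝ) (hY : MemLp Y p P) (β : ℝ) (hβ : β ∈ Set.Ico (0 : ℝ) 1) :
    (⨅ t : ℝ, t + (1 - β)⁻¹ * (∫ ω, (max (Y ω - t) 0) ^ p.toReal ∂P) ^ (1 / p.toReal)) =
    sSup {r : ℝ | ∃ Z : Ω → ℝ, MemLp Z q P ∧ (∀ᵐ ω ∂P, 0 ≤ Z ω) ∧
      (∫ ω, Z ω ∂P) = 1 ∧ eLpNorm Z q P ≤ ENNReal.ofReal ((1 - β)⁻¹) ∧
      r = ∫ ω, Y ω * Z ω ∂P} := by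
  obtain ⟨hβ0, hβ1⟩ := hβ
  set c := (1 - β)⁻¹ with hcdef
  have hc : 1 ≤ c := (one_le_inv₀ (by linarith)).2 (by linarith)
  have hp0 : p ≠ 0 := (zero_lt_one.trans_le hp).ne'
  have : Fact (1 ≤ p) := ⟨hp⟩
  have hpq1 : p⁻¹ + q⁻¹ = 1 := by simpa using hpq
  have hconj : p.HolderConjugate q := ⟨by simpa using hpq1⟩
  have hq1 : Fact (1 ≤ q) := ⟨ENNReal.HolderConjugate.one_le q p⟩
  let e : Lp ℝ p P := Lp.const p P (1:ℝ)
  have hecoe : e =ᵐ[P] fun _ => (1:ℝ) := Lp.coeFn_const p P (1:ℝ)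
  have he : ‖e‖ = 1 := by
    rw [Lp.norm_const' (p := p) (μ := P) (c := (1:ℝ)) hp0 hp']; simp
  have he0 : 0 ≤ e := by
    rw [← Lp.coeFn_nonneg]
    filter_upwards [hecoe] with x hx
    rw [hx]; exact zero_le_one
  have hposcoe : ∀ X : Lp ℝ p P, ⇑(X⁺) =ᵐ[P] fun ω => max (X ω) 0 := by
    intro X
    filter_upwards [Lp.coeFn_sup X 0, Lp.coeFn_zero ℝ p P] with x h1 h2
    change (X ⊔ 0 : Lp ℝ p P) x = _
    rw [h1, Pi.sup_apply, h2]; rfl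
  have hsm : ∀ (k : ℝ) (x : Lp ℝ p P), 0 < k → ‖(k • x)⁺‖ = k * ‖x⁺‖ := by
    intro k x hk
    have : (k • x)⁺ = k • x⁺ := by
      apply Lp.ext
      filter_upwards [hposcoe (k • x), hposcoe x, Lp.coeFn_smul k x, Lp.coeFn_smul k x⁺]
        with ω h1 h2 h3 h4
      rw [h1, h4, Pi.smul_apply, h2, h3, Pi.smul_apply, smul_eq_mul, smul_eq_mul,
        mul_max_of_nonneg _ _ hk.le, mul_zero]
    rw [this, norm_smul, Real.norm_of_nonneg hk.le]
  let y : Lp ℝ p P := hY.toLp Y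
  have hyc : y =ᵐ[P] Y := hY.coeFn_toLp
  have hdiff : ∀ t : ℝ, ⇑(y - t • e) =ᵐ[P] fun ω => Y ω - t := by
    intro t
    filter_upwards [hyc, hecoe, Lp.coeFn_sub y (t • e), Lp.coeFn_smul t e] with ω h1 h2 h3 h4
    rw [h3, Pi.sub_apply, h4, Pi.smul_apply, h1, h2, smul_eq_mul, mul_one]
  have hterm : ∀ t : ℝ, (∫ ω, (max (Y ω - t) 0) ^ p.toReal ∂P) ^ (1 / p.toReal) =
      ‖(y - t • e)⁺‖ := by
    intro t
    rw [Lp.norm_def, (Lp.memLp _).eLpNorm_eq_integral_rpow_norm hp0 hp',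
      ENNReal.toReal_ofReal (by positivity), one_div]
    congr 1
    apply integral_congr_ae
    filter_upwards [hposcoe (y - t • e), hdiff t] with ω h1 h2
    rw [h1, h2, Real.norm_of_nonneg (le_max_right _ _)]
  simp only [hterm]
  have weak : ∀ r ∈ {r : ℝ | ∃ Z : Ω → ℝ, MemLp Z q P ∧ (∀ᵐ ω ∂P, 0 ≤ Z ω) ∧
      (∫ ω, Z ω ∂P) = 1 ∧ eLpNorm Z q P ≤ ENNReal.ofReal c ∧
      r = ∫ ω, Y ω * Z ω ∂P}, ∀ t : ℝ, r ≤ t + c * ‖(y - t • e)⁺‖ := by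
    rintro _ ⟨Z, hZ, hZ0, hZ1, hZc, rfl⟩ t
    have hZi : Integrable Z P := hZ.integrable hq1.out
    have hint : ∀ X : Lp ℝ p P, Integrable (fun ω => X ω * Z ω) P := fun X =>
      (Lp.memLp X).integrable_mul hZ
    have hYZ : Integrable (fun ω => Y ω * Z ω) P := hY.integrable_mul hZ
    have h1 : ∫ ω, Y ω * Z ω ∂P = t + ∫ ω, (y - t • e : Lp ℝ p P) ω * Z ω ∂P := by
      have : ∫ ω, (y - t • e : Lp ℝ p P) ω * Z ω ∂P = ∫ ω, (Y ω * Z ω - t * Z ω) ∂P := by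
        apply integral_congr_ae
        filter_upwards [hdiff t] with ω h
        rw [h]; ring
      rw [this, integral_sub hYZ (hZi.const_mul t), integral_const_mul, hZ1]; ring
    have h2 : ∫ ω, (y - t • e : Lp ℝ p P) ω * Z ω ∂P ≤
        ∫ ω, ((y - t • e)⁺ : Lp ℝ p P) ω * Z ω ∂P := by
      refine integral_mono_ae (hint _) (hint _) ?_
      filter_upwards [hposcoe (y - t • e), hZ0] with ω h h'
      change (y - t • e : Lp ℝ p P) ω * Z ω ≤ ((y - t • e)⁺ : Lp ℝ p P) ω * Z ω
      rw [h]
      exact mul_le_mul_of_nonneg_right (le_max_left _ _) h'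
    have h3 : ∫ ω, ((y - t • e)⁺ : Lp ℝ p P) ω * Z ω ∂P ≤ c * ‖(y - t • e)⁺‖ := by
      exact holder_aux P p q hconj c (by linarith) _ Z hZ hZc
    linarith
  obtain ⟨G, hG0, hGc, hGe, hGy⟩ := hb_aux e he he0 hsm c hc y
  obtain ⟨Z, hZ, hZ0, hZc, hrep⟩ := rep_aux P p q hp' hpq1 c hc G hGc hG0
  have hZ1 : ∫ ω, Z ω ∂P = 1 := by
    rw [← hGe, hrep]
    apply integral_congr_ae
    filter_upwards [hecoe] with ω h
    rw [h, one_mul]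
  have hmem : (∫ ω, Y ω * Z ω ∂P) ∈ {r : ℝ | ∃ Z : Ω → ℝ, MemLp Z q P ∧ (∀ᵐ ω ∂P, 0 ≤ Z ω) ∧
      (∫ ω, Z ω ∂P) = 1 ∧ eLpNorm Z q P ≤ ENNReal.ofReal c ∧
      r = ∫ ω, Y ω * Z ω ∂P} := ⟨Z, hZ, hZ0, hZ1, hZc, rfl⟩
  refine le_antisymm ?_ ?_
  · rw [← hGy, hrep]
    have : ∫ ω, y ω * Z ω ∂P = ∫ ω, Y ω * Z ω ∂P := by
      apply integral_congr_ae
      filter_upwards [hyc] with ω h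
      rw [h]
    rw [this]
    exact le_csSup ⟨_, fun r hr => weak r hr 0⟩ hmem
  · exact csSup_le ⟨_, hmem⟩ fun r hr => le_ciInf fun t => weak r hr t
end

section
/- Let σ be a spectral function, let β ∈ (0,1), let u_β ∈ (0,1) be the (unique) solution of ∫_0^{u_β} σ(u) du = β, and define the spectral function σ_β by σ_β(u) = 0 for u < u_β and σ_β(u) = σ(u)/(1−β) for u ≥ u_β. Then for every integrable random variable Y with ∫_0^1 σ(u)·|F_Y^{-1}(u)| du < ∞ it holds that inf_{t ∈ ℝ} ( t + (1−β)^{-1}·R_σ((Y−t)₊) ) = R_{σ_β}(Y) = (1−β)^{-1} ∫_{u_β}^1 σ(u)·F_Y^{-1}(u) du, and the infimum is attained at t* = F_Y^{-1}(u_β). -/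
open MeasureTheory Set

/-- Cumulative distribution function `F_Y(x) = P(Y ≤ x)`. -/
noncomputable def cdfR {Ω : Type*} [MeasurableSpace Ω] (P : Measure Ω) (Y : Ω → ℝ)
    (x : ℝ) : ℝ :=
  (P {ω | Y ω ≤ x}).toReal

/-- Quantile function `F_Y⁻¹(u) = inf {x : F_Y(x) ≥ u}`. -/
noncomputable def quantR {Ω : Type*} [MeasurableSpace Ω] (P : Measure Ω) (Y : Ω → ℝ)
    (u : ℝ) : ℝ :=
  sInf {x : ℝ | u ≤ cdfR P Y x}

/-- Spectral risk measure `R_σ(Y) = ∫_0^1 σ(u) F_Y⁻¹(u) du`. -/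
noncomputable def specR {Ω : Type*} [MeasurableSpace Ω] (P : Measure Ω) (σ : ℝ → ℝ)
    (Y : Ω → ℝ) : ℝ :=
  ∫ u in (0 : ℝ)..1, σ u * quantR P Y u

lemma cdfR_mono' {Ω : Type*} [MeasurableSpace Ω] (P : Measure Ω) [IsProbabilityMeasure P]
    (Y : Ω → ℝ) : Monotone (cdfR P Y) := by
  intro a b hab
  unfold cdfR
  apply ENNReal.toReal_mono (measure_ne_top _ _)
  exact measure_mono (fun ω (h : Y ω ≤ a) => h.trans hab)

lemma cdfR_eq_cdf {Ω : Type*} [MeasurableSpace Ω] (P : Measure Ω) [IsProbabilityMeasure P]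
    (Y : Ω → ℝ) (hY : AEMeasurable Y P) :
    cdfR P Y = ProbabilityTheory.cdf (P.map Y) := by
  have : IsProbabilityMeasure (P.map Y) := Measure.isProbabilityMeasure_map hY
  ext x
  rw [ProbabilityTheory.cdf_eq_real, measureReal_def,
    Measure.map_apply_of_aemeasurable hY measurableSet_Iic]
  rfl

lemma quant_set_props {Ω : Type*} [MeasurableSpace Ω] (P : Measure Ω) [IsProbabilityMeasure P]
    (Y : Ω → ℝ) (hY : AEMeasurable Y P) (u : ℝ) (hu : u ∈ Ioo (0 : ℝ) 1) :
    {x : ℝ | u ≤ cdfR P Y x}.Nonempty ∧ BddBelow {x : ℝ | u ≤ cdfR P Y x} := by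
  have hmono := cdfR_mono' P Y
  have h1 := ProbabilityTheory.tendsto_cdf_atTop (P.map Y)
  have h0 := ProbabilityTheory.tendsto_cdf_atBot (P.map Y)
  rw [← cdfR_eq_cdf P Y hY] at h0 h1
  constructor
  · obtain ⟨x, hx⟩ := (h1.eventually (lt_mem_nhds hu.2)).exists
    exact ⟨x, hx.le⟩
  · obtain ⟨x, hx⟩ := (h0.eventually (gt_mem_nhds hu.1)).exists
    refine ⟨x, fun y hy => ?_⟩
    by_contra hlt
    push Not at hlt
    have := hmono hlt.le
    have hy' : u ≤ cdfR P Y y := hy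
    linarith

lemma quantR_monoOn {Ω : Type*} [MeasurableSpace Ω] (P : Measure Ω) [IsProbabilityMeasure P]
    (Y : Ω → ℝ) (hY : AEMeasurable Y P) : MonotoneOn (quantR P Y) (Ioo 0 1) := by
  intro a ha b hb hab
  exact csInf_le_csInf (quant_set_props P Y hY a ha).2 (quant_set_props P Y hY b hb).1
    (fun x hx => hab.trans hx)

lemma quantR_pos_part {Ω : Type*} [MeasurableSpace Ω] (P : Measure Ω) [IsProbabilityMeasure P]
    (Y : Ω → ℝ) (hY : AEMeasurable Y P) (t u : ℝ) (hu : u ∈ Ioo (0 : ℝ) 1) :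
    quantR P (fun ω => max (Y ω - t) 0) u = max (quantR P Y u - t) 0 := by
  obtain ⟨hne, hbd⟩ := quant_set_props P Y hY u hu
  have hmono := cdfR_mono' P Y
  have hset : {z : ℝ | u ≤ cdfR P (fun ω => max (Y ω - t) 0) z}
      = {z : ℝ | 0 ≤ z ∧ u ≤ cdfR P Y (z + t)} := by
    ext z
    simp only [mem_setOf_eq]
    by_cases hz : 0 ≤ z
    · have : cdfR P (fun ω => max (Y ω - t) 0) z = cdfR P Y (z + t) := by
        unfold cdfR
        congr 2
        ext ω
        simp [hz]
      simp [hz, this]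
    · have : cdfR P (fun ω => max (Y ω - t) 0) z = 0 := by
        unfold cdfR
        simp [hz]
      simp [hz, this, hu.1]
  have hlb : ∀ z ∈ {z : ℝ | 0 ≤ z ∧ u ≤ cdfR P Y (z + t)}, max (quantR P Y u - t) 0 ≤ z := by
    rintro z ⟨hz, hz'⟩
    have : quantR P Y u ≤ z + t := csInf_le hbd hz'
    exact max_le (by linarith) hz
  have hmem : ∀ w, max (quantR P Y u - t) 0 < w → w ∈ {z : ℝ | 0 ≤ z ∧ u ≤ cdfR P Y (z + t)} := by
    intro w hw
    obtain ⟨h1, h2⟩ := max_lt_iff.1 hw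
    have h3 : sInf {x : ℝ | u ≤ cdfR P Y x} < w + t := by
      change quantR P Y u < w + t
      linarith
    obtain ⟨s, hs, hsw⟩ := exists_lt_of_csInf_lt hne h3
    exact ⟨h2.le, le_trans hs (hmono hsw.le)⟩
  have hq : quantR P (fun ω => max (Y ω - t) 0) u
      = sInf {z : ℝ | 0 ≤ z ∧ u ≤ cdfR P Y (z + t)} := by
    rw [← hset]; rfl
  rw [hq]
  apply csInf_eq_of_forall_ge_of_forall_gt_exists_lt
  · exact ⟨_, hmem _ (lt_add_one _)⟩
  · exact hlb
  · intro w hw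
    obtain ⟨v, hv1, hv2⟩ := exists_between hw
    exact ⟨v, hmem v hv1, hv2⟩

lemma spec_core (σ q : ℝ → ℝ) (hσ0 : ∀ u ∈ Set.Ico (0 : ℝ) 1, 0 ≤ σ u)
    (hσi : IntervalIntegrable σ volume 0 1)
    (hq : MonotoneOn q (Ioo 0 1))
    (hfin : IntervalIntegrable (fun u => σ u * |q u|) volume 0 1) :
    IntervalIntegrable (fun u => σ u * q u) volume 0 1 ∧
    ∀ t, IntervalIntegrable (fun u => σ u * max (q u - t) 0) volume 0 1 := by
  rw [intervalIntegrable_iff_integrableOn_Ioo_of_le zero_le_one] at *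
  have hqm : AEStronglyMeasurable q (volume.restrict (Ioo 0 1)) :=
    (aemeasurable_restrict_of_monotoneOn measurableSet_Ioo hq).aestronglyMeasurable
  have hσm := hσi.aestronglyMeasurable
  constructor
  · refine Integrable.mono hfin (hσm.mul hqm) (Filter.Eventually.of_forall fun u => ?_)
    simp
  · intro t
    rw [intervalIntegrable_iff_integrableOn_Ioo_of_le zero_le_one]
    have hm : AEStronglyMeasurable (fun u => max (q u - t) 0) (volume.restrict (Ioo 0 1)) :=
      (hqm.sub aestronglyMeasurable_const).sup aestronglyMeasurable_const
    refine Integrable.mono' (hfin.add (hσi.mul_const |t|)) (hσm.mul hm) ?_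
    filter_upwards [ae_restrict_mem measurableSet_Ioo] with u hu
    have h0 := hσ0 u ⟨hu.1.le, hu.2⟩
    have h1 : |max (q u - t) 0| ≤ |q u| + |t| := by
      rw [abs_of_nonneg (le_max_right _ _)]
      exact max_le ((le_abs_self _).trans (abs_sub _ _)) (by positivity)
    rw [Real.norm_eq_abs, abs_mul, abs_of_nonneg h0]
    calc σ u * |max (q u - t) 0| ≤ σ u * (|q u| + |t|) := by gcongr
      _ = _ := by simp [mul_add]

theorem stmt3 {Ω : Type*} [MeasurableSpace Ω] (P : Measure Ω) [IsProbabilityMeasure P]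
    (σ : ℝ → ℝ) (hσ0 : ∀ u ∈ Set.Ico (0 : ℝ) 1, 0 ≤ σ u)
    (hσmono : MonotoneOn σ (Set.Ico (0 : ℝ) 1))
    (hσ1 : (∫ u in (0 : ℝ)..1, σ u) = 1)
    (β : ℝ) (hβ : β ∈ Set.Ioo (0 : ℝ) 1)
    (uβ : ℝ) (huβ : uβ ∈ Set.Ioo (0 : ℝ) 1) (huβeq : (∫ u in (0 : ℝ)..uβ, σ u) = β)
    (σβ : ℝ → ℝ) (hσβ : ∀ u : ℝ, σβ u = if u < uβ then 0 else σ u / (1 - β))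
    (Y : Ω → ℝ) (hYint : Integrable Y P)
    (hfin : IntervalIntegrable (fun u => σ u * |quantR P Y u|) volume 0 1) :
    (⨅ t : ℝ, t + (1 - β)⁻¹ * specR P σ (fun ω => max (Y ω - t) 0)) = specR P σβ Y ∧
    specR P σβ Y = (1 - β)⁻¹ * ∫ u in uβ..1, σ u * quantR P Y u ∧
    quantR P Y uβ + (1 - β)⁻¹ * specR P σ (fun ω => max (Y ω - quantR P Y uβ) 0) =
      (⨅ t : ℝ, t + (1 - β)⁻¹ * specR P σ (fun ω => max (Y ω - t) 0)) := by
  have hY : AEMeasurable Y P := hYint.aemeasurable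
  have hb : 0 < 1 - β := by linarith [hβ.2]
  have hqm := quantR_monoOn P Y hY
  have hσi : IntervalIntegrable σ volume 0 1 := by
    by_contra h
    rw [intervalIntegral.integral_undef h] at hσ1
    exact zero_ne_one hσ1
  obtain ⟨hi, hit⟩ := spec_core σ (quantR P Y) hσ0 hσi hqm hfin
  have hs1 : uIcc 0 uβ ⊆ uIcc 0 1 := by
    rw [uIcc_of_le huβ.1.le, uIcc_of_le zero_le_one]; exact Icc_subset_Icc_right huβ.2.le
  have hs2 : uIcc uβ 1 ⊆ uIcc 0 1 := by
    rw [uIcc_of_le huβ.2.le, uIcc_of_le zero_le_one]; exact Icc_subset_Icc_left huβ.1.le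
  have hσ2 : (∫ u in uβ..1, σ u) = 1 - β := by
    have := intervalIntegral.integral_add_adjacent_intervals (hσi.mono_set hs1) (hσi.mono_set hs2)
    linarith
  have hspec : ∀ t, specR P σ (fun ω => max (Y ω - t) 0)
      = (∫ u in (0:ℝ)..uβ, σ u * max (quantR P Y u - t) 0)
        + ∫ u in uβ..1, σ u * max (quantR P Y u - t) 0 := by
    intro t
    rw [intervalIntegral.integral_add_adjacent_intervals ((hit t).mono_set hs1)
      ((hit t).mono_set hs2)]
    apply intervalIntegral.integral_congr_Ioo_of_le zero_le_one
    intro u hu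
    simp only [quantR_pos_part P Y hY t u hu]
  have hlin : ∀ t, (∫ u in uβ..1, σ u * (quantR P Y u - t))
      = (∫ u in uβ..1, σ u * quantR P Y u) - (1 - β) * t := by
    intro t
    rw [← hσ2, ← intervalIntegral.integral_mul_const, ← intervalIntegral.integral_sub
      (hi.mono_set hs2) ((hσi.mono_set hs2).mul_const t)]
    simp only [mul_sub]
  have hlini : ∀ t, IntervalIntegrable (fun u => σ u * (quantR P Y u - t)) volume uβ 1 := by
    intro t
    have := (hi.mono_set hs2).sub ((hσi.mono_set hs2).mul_const t)
    simpa only [mul_sub] using this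
  have hge : ∀ t, (1 - β)⁻¹ * (∫ u in uβ..1, σ u * quantR P Y u)
      ≤ t + (1 - β)⁻¹ * specR P σ (fun ω => max (Y ω - t) 0) := by
    intro t
    have h1 : 0 ≤ ∫ u in (0:ℝ)..uβ, σ u * max (quantR P Y u - t) 0 := by
      apply intervalIntegral.integral_nonneg huβ.1.le
      intro u hu
      exact mul_nonneg (hσ0 u ⟨hu.1, hu.2.trans_lt huβ.2⟩) (le_max_right _ _)
    have h2 : (∫ u in uβ..1, σ u * (quantR P Y u - t))
        ≤ ∫ u in uβ..1, σ u * max (quantR P Y u - t) 0 := by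
      apply intervalIntegral.integral_mono_on_of_le_Ioo huβ.2.le (hlini t)
        ((hit t).mono_set hs2)
      intro u hu
      exact mul_le_mul_of_nonneg_left (le_max_left _ _)
        (hσ0 u ⟨huβ.1.le.trans hu.1.le, hu.2⟩)
    rw [hlin] at h2
    rw [hspec]
    rw [inv_mul_le_iff₀ hb, mul_add, mul_inv_cancel_left₀ hb.ne']
    linarith
  have heq : quantR P Y uβ + (1 - β)⁻¹ * specR P σ (fun ω => max (Y ω - quantR P Y uβ) 0)
      = (1 - β)⁻¹ * (∫ u in uβ..1, σ u * quantR P Y u) := by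
    have h1 : (∫ u in (0:ℝ)..uβ, σ u * max (quantR P Y u - quantR P Y uβ) 0) = 0 := by
      rw [intervalIntegral.integral_congr_Ioo_of_le (g := fun _ => (0:ℝ)) huβ.1.le]
      · simp
      · intro u hu
        have := hqm ⟨hu.1, hu.2.trans huβ.2⟩ huβ hu.2.le
        simp [max_eq_right (sub_nonpos.2 this)]
    have h2 : (∫ u in uβ..1, σ u * max (quantR P Y u - quantR P Y uβ) 0)
        = ∫ u in uβ..1, σ u * (quantR P Y u - quantR P Y uβ) := by
      apply intervalIntegral.integral_congr_Ioo_of_le huβ.2.le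
      intro u hu
      have := hqm huβ ⟨huβ.1.trans hu.1, hu.2⟩ hu.1.le
      simp only [max_eq_left (sub_nonneg.2 this)]
    rw [hspec, h1, h2, hlin]
    field_simp
    ring
  have hinf : (⨅ t : ℝ, t + (1 - β)⁻¹ * specR P σ (fun ω => max (Y ω - t) 0))
      = (1 - β)⁻¹ * (∫ u in uβ..1, σ u * quantR P Y u) := by
    apply le_antisymm
    · rw [← heq]
      exact ciInf_le ⟨_, by rintro _ ⟨t, rfl⟩; exact hge t⟩ (quantR P Y uβ)
    · exact le_ciInf hge
  have hσβR : specR P σβ Y = (1 - β)⁻¹ * ∫ u in uβ..1, σ u * quantR P Y u := by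
    have e1 : EqOn (fun _ => (0:ℝ)) (fun u => σβ u * quantR P Y u) (Ioo 0 uβ) := by
      intro u hu
      simp [hσβ, hu.2]
    have e2 : EqOn (fun u => (1 - β)⁻¹ * (σ u * quantR P Y u))
        (fun u => σβ u * quantR P Y u) (Ioo uβ 1) := by
      intro u hu
      simp only [hσβ, not_lt.2 hu.1.le, if_false]
      ring
    have i1 : IntervalIntegrable (fun u => σβ u * quantR P Y u) volume 0 uβ :=
      IntervalIntegrable.congr_uIoo (f := fun _ => (0:ℝ)) (by simp)
        (by rw [uIoo_of_le huβ.1.le]; exact e1)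
    have i2 : IntervalIntegrable (fun u => σβ u * quantR P Y u) volume uβ 1 :=
      IntervalIntegrable.congr_uIoo ((hi.mono_set hs2).const_mul _)
        (by rw [uIoo_of_le huβ.2.le]; exact e2)
    unfold specR
    rw [← intervalIntegral.integral_add_adjacent_intervals i1 i2,
      ← intervalIntegral.integral_congr_Ioo_of_le huβ.1.le e1,
      ← intervalIntegral.integral_congr_Ioo_of_le huβ.2.le e2]
    simp
  exact ⟨hinf.trans hσβR.symm, hσβR, heq.trans hinf.symm⟩
end

section
/- Let σ be a spectral function, β ∈ (0,1), u_β ∈ (0,1) the solution of ∫_0^{u_β} σ(u) du = β, and set Σ(u) = ∫_u^1 σ(p) dp and Σ_β(u) = min(1, (1−β)^{-1} ∫_u^1 σ(p) dp). For every integrable Y with ∫_0^1 σ(u)·|F_Y^{-1}(u)| du < ∞, the higher order spectral risk measure satisfies inf_{t ∈ ℝ} ( t + (1−β)^{-1}·R_σ((Y−t)₊) ) = F_Y^{-1}(u_β) + (1−β)^{-1} ∫_{F_Y^{-1}(u_β)}^∞ Σ(F_Y(y)) dy; moreover, if Y is bounded, this quantity also equals essinf Y + ∫_{essinf Y}^∞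 Σ_β(F_Y(y)) dy. -/
open MeasureTheory Set

section aux
variable {Ω : Type*} [MeasurableSpace Ω] {P : Measure Ω} [IsProbabilityMeasure P] {Y : Ω → ℝ}

lemma cdfR_eq (hY : AEMeasurable Y P) (x : ℝ) :
    cdfR P Y x = ProbabilityTheory.cdf (P.map Y) x := by
  haveI : IsProbabilityMeasure (P.map Y) := Measure.isProbabilityMeasure_map hY
  rw [ProbabilityTheory.cdf_eq_real, cdfR, measureReal_def,
    Measure.map_apply_of_aemeasurable hY measurableSet_Iic]
  rfl

lemma cdfR_nonneg' (x : ℝ) : 0 ≤ cdfR P Y x := ENNReal.toReal_nonneg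

lemma cdfR_le_one' (x : ℝ) : cdfR P Y x ≤ 1 := by
  have : P.real {ω | Y ω ≤ x} ≤ 1 := measureReal_le_one
  exact this

lemma cdfR_mono : Monotone (cdfR P Y) := fun a b h => by
  refine ENNReal.toReal_mono (measure_ne_top _ _) (measure_mono ?_)
  intro ω hω
  exact le_trans hω h

lemma quant_gc (hY : AEMeasurable Y P) {u : ℝ} (hu : u ∈ Ioo (0 : ℝ) 1) (y : ℝ) :
    quantR P Y u ≤ y ↔ u ≤ cdfR P Y y := by
  have hbdd : BddBelow {x : ℝ | u ≤ cdfR P Y x} := by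
    have h := (ProbabilityTheory.tendsto_cdf_atBot (P.map Y)).eventually (gt_mem_nhds hu.1)
    obtain ⟨b, hb⟩ := h.exists
    refine ⟨b, fun x hx => ?_⟩
    by_contra! hlt
    have h1 := cdfR_mono (P := P) (Y := Y) hlt.le
    have h2 := cdfR_eq hY b
    have hx' : u ≤ cdfR P Y x := hx
    linarith
  have hne : {x : ℝ | u ≤ cdfR P Y x}.Nonempty := by
    have h := (ProbabilityTheory.tendsto_cdf_atTop (P.map Y)).eventually (lt_mem_nhds hu.2)
    obtain ⟨b, hb⟩ := h.exists
    refine ⟨b, ?_⟩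
    show u ≤ cdfR P Y b
    rw [cdfR_eq hY]; exact hb.le
  constructor
  · intro h
    have key : ∀ z, y < z → u ≤ cdfR P Y z := by
      intro z hz
      obtain ⟨x, hx, hxz⟩ := exists_lt_of_csInf_lt hne (lt_of_le_of_lt h hz)
      exact le_trans hx (cdfR_mono hxz.le)
    have hc := (ProbabilityTheory.cdf (P.map Y)).right_continuous y
    have hc' : Filter.Tendsto (ProbabilityTheory.cdf (P.map Y)) (nhdsWithin y (Ioi y))
        (nhds (ProbabilityTheory.cdf (P.map Y) y)) :=
      hc.tendsto.mono_left (nhdsWithin_mono _ Ioi_subset_Ici_self)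
    rw [cdfR_eq hY]
    refine ge_of_tendsto hc' ?_
    filter_upwards [self_mem_nhdsWithin] with z hz
    rw [← cdfR_eq hY]
    exact key z hz
  · intro h
    exact csInf_le hbdd h

lemma quant_mono (hY : AEMeasurable Y P) : MonotoneOn (quantR P Y) (Ioo (0 : ℝ) 1) := by
  intro u hu v hv huv
  rw [quant_gc hY hu]
  exact huv.trans ((quant_gc hY hv _).1 le_rfl)

lemma quant_pos (hY : AEMeasurable Y P) {u : ℝ} (hu : u ∈ Ioo (0 : ℝ) 1) (t : ℝ) :
    quantR P (fun ω => max (Y ω - t) 0) u = max (quantR P Y u - t) 0 := by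
  refine eq_of_forall_ge_iff fun y => ?_
  have hZ : AEMeasurable (fun ω => max (Y ω - t) 0) P :=
    (hY.sub_const t).max aemeasurable_const
  rw [quant_gc hZ hu, max_le_iff, sub_le_iff_le_add, quant_gc hY hu]
  by_cases hy : 0 ≤ y
  · have : cdfR P (fun ω => max (Y ω - t) 0) y = cdfR P Y (y + t) := by
      unfold cdfR
      congr 2
      ext ω
      simp [hy]
    rw [this]; simp [hy]
  · have : cdfR P (fun ω => max (Y ω - t) 0) y = 0 := by
      unfold cdfR
      have : {ω | max (Y ω - t) 0 ≤ y} = ∅ := by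
        ext ω
        simp [hy]
      rw [this]; simp
    rw [this]
    simp only [hy, and_false, iff_false, not_le]
    exact hu.1

lemma specR_pos (hY : AEMeasurable Y P) (σ : ℝ → ℝ) (t : ℝ) :
    specR P σ (fun ω => max (Y ω - t) 0) =
      ∫ u in Ioo (0 : ℝ) 1, σ u * max (quantR P Y u - t) 0 := by
  unfold specR
  rw [intervalIntegral.integral_of_le zero_le_one, integral_Ioc_eq_integral_Ioo]
  refine setIntegral_congr_fun measurableSet_Ioo fun u hu => ?_
  rw [quant_pos hY hu]

lemma integrable_pos (hY : AEMeasurable Y P) {σ : ℝ → ℝ}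
    (hσ0 : ∀ u ∈ Set.Ico (0 : ℝ) 1, 0 ≤ σ u)
    (hσi : IntegrableOn σ (Ioo (0 : ℝ) 1))
    (hf : IntegrableOn (fun u => σ u * |quantR P Y u|) (Ioo (0 : ℝ) 1)) (t : ℝ) :
    IntegrableOn (fun u => σ u * max (quantR P Y u - t) 0) (Ioo (0 : ℝ) 1) := by
  have hq : AEMeasurable (quantR P Y) (volume.restrict (Ioo (0 : ℝ) 1)) :=
    aemeasurable_restrict_of_monotoneOn measurableSet_Ioo (quant_mono hY)
  have hb : IntegrableOn (fun u => σ u * |quantR P Y u| + σ u * |t|) (Ioo (0 : ℝ) 1) :=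
    Integrable.add hf (hσi.mul_const _)
  refine Integrable.mono' hb ?_ ?_
  · exact hσi.aestronglyMeasurable.mul
      ((hq.sub_const t).max aemeasurable_const).aestronglyMeasurable
  · filter_upwards [ae_restrict_mem measurableSet_Ioo] with u hu
    have h0 := hσ0 u ⟨hu.1.le, hu.2⟩
    rw [Real.norm_of_nonneg (mul_nonneg h0 (le_max_right _ _)), ← mul_add]
    refine mul_le_mul_of_nonneg_left (max_le ?_ (by positivity)) h0
    have := le_abs_self (quantR P Y u)
    have := neg_abs_le t
    linarith

lemma layer (hY : AEMeasurable Y P) {σ : ℝ → ℝ}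
    (hσ0 : ∀ u ∈ Set.Ico (0 : ℝ) 1, 0 ≤ σ u)
    (hσi : IntegrableOn σ (Ioo (0 : ℝ) 1))
    (hf : IntegrableOn (fun u => σ u * |quantR P Y u|) (Ioo (0 : ℝ) 1)) (t : ℝ) :
    ∫ u in Ioo (0 : ℝ) 1, σ u * max (quantR P Y u - t) 0 =
      ∫ y in Ioi t, (∫ p in (cdfR P Y y)..1, σ p) := by
  set d : ℝ → ENNReal := fun u => ENNReal.ofReal (σ u) with hd
  set μ := volume.restrict (Ioo (0 : ℝ) 1) with hμ
  have hdm : AEMeasurable d μ := hσi.aestronglyMeasurable.aemeasurable.ennreal_ofReal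
  have hdt : ∀ᵐ x ∂μ, d x < ⊤ := Filter.Eventually.of_forall fun x => ENNReal.ofReal_lt_top
  have hae : ∀ᵐ u ∂μ, (d u).toReal • max (quantR P Y u - t) 0
      = σ u * max (quantR P Y u - t) 0 := by
    filter_upwards [ae_restrict_mem measurableSet_Ioo] with u hu
    rw [hd, smul_eq_mul, ENNReal.toReal_ofReal (hσ0 u ⟨hu.1.le, hu.2⟩)]
  have hint : Integrable (fun u => max (quantR P Y u - t) 0) (μ.withDensity d) := by
    rw [integrable_withDensity_iff_integrable_smul₀' hdm hdt]
    exact (integrable_congr hae).2 (integrable_pos hY hσ0 hσi hf t)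
  rw [← integral_congr_ae hae, ← integral_withDensity_eq_integral_toReal_smul₀ hdm hdt,
    hint.integral_eq_integral_meas_lt (Filter.Eventually.of_forall fun u => le_max_right _ _)]
  have hsh := (measurePreserving_add_right volume t).setIntegral_preimage_emb
    (measurableEmbedding_addRight t) (fun y => ∫ p in (cdfR P Y y)..1, σ p) (Ioi t)
  rw [← hsh]
  have : (fun x => x + t) ⁻¹' Ioi t = Ioi 0 := by ext x; simp
  rw [this]
  refine setIntegral_congr_fun measurableSet_Ioi fun y hy => ?_
  have hy : 0 < y := hy
  set F := cdfR P Y (y + t) with hF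
  have hF0 : 0 ≤ F := cdfR_nonneg' _
  have hF1 : F ≤ 1 := cdfR_le_one' _
  have hset : ({a | y < max (quantR P Y a - t) 0} : Set ℝ) =ᵐ[μ.withDensity d] Ioi F := by
    refine (withDensity_absolutelyContinuous μ d).ae_le ?_
    filter_upwards [ae_restrict_mem measurableSet_Ioo] with u hu
    refine propext ?_
    show y < max (quantR P Y u - t) 0 ↔ F < u
    rw [← not_le, ← not_le, not_iff_not, max_le_iff, sub_le_iff_le_add, quant_gc hY hu]
    simp [hy.le, hF]
  rw [measureReal_congr hset, measureReal_def, withDensity_apply _ measurableSet_Ioi, hμ,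
    Measure.restrict_restrict measurableSet_Ioi]
  have hI : Ioi F ∩ Ioo 0 1 = Ioo F 1 := by
    ext x; simp only [mem_inter_iff, mem_Ioi, mem_Ioo]
    constructor
    · rintro ⟨h1, h2, h3⟩; exact ⟨h1, h3⟩
    · rintro ⟨h1, h2⟩; exact ⟨h1, by linarith, h2⟩
  have hsub : Ioo F 1 ⊆ Ioo 0 1 := Ioo_subset_Ioo_left hF0
  have hnn : 0 ≤ᵐ[volume.restrict (Ioo F 1)] σ := by
    filter_upwards [ae_restrict_mem measurableSet_Ioo] with u hu
    exact hσ0 u ⟨(hsub hu).1.le, hu.2⟩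
  rw [hI, ← ofReal_integral_eq_lintegral_ofReal (hσi.mono_set hsub) hnn,
    ENNReal.toReal_ofReal (integral_nonneg_of_ae hnn),
    intervalIntegral.integral_of_le hF1, integral_Ioc_eq_integral_Ioo]

end aux

theorem stmt4 {Ω : Type*} [MeasurableSpace Ω] (P : Measure Ω) [IsProbabilityMeasure P]
    (σ : ℝ → ℝ) (hσ0 : ∀ u ∈ Set.Ico (0 : ℝ) 1, 0 ≤ σ u)
    (hσmono : MonotoneOn σ (Set.Ico (0 : ℝ) 1))
    (hσ1 : (∫ u in (0 : ℝ)..1, σ u) = 1)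
    (β : ℝ) (hβ : β ∈ Set.Ioo (0 : ℝ) 1)
    (uβ : ℝ) (huβ : uβ ∈ Set.Ioo (0 : ℝ) 1) (huβeq : (∫ u in (0 : ℝ)..uβ, σ u) = β)
    (Y : Ω → ℝ) (hYint : Integrable Y P)
    (hfin : IntervalIntegrable (fun u => σ u * |quantR P Y u|) volume 0 1) :
    (⨅ t : ℝ, t + (1 - β)⁻¹ * specR P σ (fun ω => max (Y ω - t) 0)) =
      quantR P Y uβ +
        (1 - β)⁻¹ * ∫ y in Set.Ioi (quantR P Y uβ), (∫ p in (cdfR P Y y)..1, σ p) ∧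
    ((∃ C : ℝ, ∀ ω, |Y ω| ≤ C) →
      (⨅ t : ℝ, t + (1 - β)⁻¹ * specR P σ (fun ω => max (Y ω - t) 0)) =
        essInf Y P +
          ∫ y in Set.Ioi (essInf Y P),
            min 1 ((1 - β)⁻¹ * ∫ p in (cdfR P Y y)..1, σ p)) := by
  have hY : AEMeasurable Y P := hYint.aestronglyMeasurable.aemeasurable
  have hii : IntervalIntegrable σ volume 0 1 := by
    by_contra h
    rw [intervalIntegral.integral_undef h] at hσ1
    exact zero_ne_one hσ1
  have hσi : IntegrableOn σ (Ioo (0 : ℝ) 1) :=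
    ((intervalIntegrable_iff_integrableOn_Ioc_of_le zero_le_one).1 hii).mono_set Ioo_subset_Ioc_self
  have hf : IntegrableOn (fun u => σ u * |quantR P Y u|) (Ioo (0 : ℝ) 1) :=
    ((intervalIntegrable_iff_integrableOn_Ioc_of_le zero_le_one).1 hfin).mono_set
      Ioo_subset_Ioc_self
  have hsubi : ∀ a b, a ∈ Icc (0 : ℝ) 1 → b ∈ Icc (0 : ℝ) 1 → IntervalIntegrable σ volume a b := by
    intro a b ha hb
    refine hii.mono_set ?_
    rw [uIcc_of_le zero_le_one]
    exact uIcc_subset_Icc ha hb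
  have hu' : uβ ∈ Icc (0 : ℝ) 1 := ⟨huβ.1.le, huβ.2.le⟩
  have h0' : (0 : ℝ) ∈ Icc (0 : ℝ) 1 := by simp
  have h1' : (1 : ℝ) ∈ Icc (0 : ℝ) 1 := by simp
  have htail : (∫ u in uβ..1, σ u) = 1 - β := by
    have := intervalIntegral.integral_add_adjacent_intervals (hsubi 0 uβ h0' hu') (hsubi uβ 1 hu' h1')
    linarith
  have hβ1 : 0 < 1 - β := by linarith [hβ.2]
  have hβi : 0 < (1 - β)⁻¹ := inv_pos.2 hβ1
  -- tail function antitone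
  have hanti : ∀ a b, a ∈ Icc (0 : ℝ) 1 → b ∈ Icc (0 : ℝ) 1 → a ≤ b →
      (∫ p in b..1, σ p) ≤ ∫ p in a..1, σ p := by
    intro a b ha hb hab
    have h := intervalIntegral.integral_add_adjacent_intervals (hsubi a b ha hb) (hsubi b 1 hb h1')
    have h2 : 0 ≤ ∫ p in a..b, σ p := by
      rw [intervalIntegral.integral_of_le hab, integral_Ioc_eq_integral_Ioo]
      refine setIntegral_nonneg measurableSet_Ioo fun u hu => hσ0 u ⟨?_, ?_⟩
      · linarith [hu.1, ha.1]
      · linarith [hu.2, hb.2]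
    linarith
  have hFm : ∀ y, cdfR P Y y ∈ Icc (0 : ℝ) 1 := fun y => ⟨cdfR_nonneg' y, cdfR_le_one' y⟩
  set t0 := quantR P Y uβ with ht0
  have hmin : ∀ t : ℝ, (t0 - t) * (1 - β) + specR P σ (fun ω => max (Y ω - t0) 0) ≤
      specR P σ (fun ω => max (Y ω - t) 0) := by
    intro t
    rw [specR_pos hY, specR_pos hY]
    have e1 : (t0 - t) * (1 - β) =
        ∫ u in Ioo (0 : ℝ) 1, (t0 - t) * (Ioi uβ).indicator σ u := by
      rw [integral_const_mul, setIntegral_indicator measurableSet_Ioi, ← htail,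
        intervalIntegral.integral_of_le hu'.2, integral_Ioc_eq_integral_Ioo]
      congr 3
      ext x; simp only [mem_inter_iff, mem_Ioi, mem_Ioo]
      constructor
      · rintro ⟨h1, h2⟩; exact ⟨⟨by linarith [huβ.1], h2⟩, h1⟩
      · rintro ⟨⟨h1, h2⟩, h3⟩; exact ⟨h3, h2⟩
    have i1 : IntegrableOn (fun u => (t0 - t) * (Ioi uβ).indicator σ u) (Ioo (0 : ℝ) 1) :=
      (Integrable.indicator hσi measurableSet_Ioi).const_mul _
    rw [e1, ← integral_add i1 (integrable_pos hY hσ0 hσi hf t0)]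
    refine setIntegral_mono_on (i1.add (integrable_pos hY hσ0 hσi hf t0))
      (integrable_pos hY hσ0 hσi hf t) measurableSet_Ioo fun u hu => ?_
    have hs := hσ0 u ⟨hu.1.le, hu.2⟩
    by_cases hc : uβ < u
    · rw [indicator_of_mem (show u ∈ Ioi uβ from hc)]
      have hq : t0 ≤ quantR P Y u := quant_mono hY huβ hu hc.le
      rw [max_eq_left (sub_nonneg.2 hq)]
      have := mul_le_mul_of_nonneg_left (le_max_left (quantR P Y u - t) 0) hs
      linarith
    · rw [indicator_of_notMem (show u ∉ Ioi uβ from hc)]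
      have hq : quantR P Y u ≤ t0 := quant_mono hY hu huβ (not_lt.1 hc)
      rw [max_eq_right (sub_nonpos.2 hq)]
      have := mul_nonneg hs (le_max_right (quantR P Y u - t) 0)
      linarith
  have hinf : (⨅ t : ℝ, t + (1 - β)⁻¹ * specR P σ (fun ω => max (Y ω - t) 0)) =
      t0 + (1 - β)⁻¹ * ∫ y in Set.Ioi t0, (∫ p in (cdfR P Y y)..1, σ p) := by
    rw [← layer hY hσ0 hσi hf t0, ← specR_pos hY]
    refine IsLeast.csInf_eq ⟨⟨t0, rfl⟩, ?_⟩
    rintro _ ⟨t, rfl⟩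
    have h := mul_le_mul_of_nonneg_left (hmin t) hβi.le
    have h2 : (1 - β)⁻¹ * ((t0 - t) * (1 - β) + specR P σ (fun ω => max (Y ω - t0) 0)) =
        t0 - t + (1 - β)⁻¹ * specR P σ (fun ω => max (Y ω - t0) 0) := by
      field_simp
    simp only
    linarith
  refine ⟨hinf, ?_⟩
  rintro ⟨C, hC⟩
  rw [hinf]
  set a := essInf Y P with ha
  have hlow : Filter.IsBoundedUnder (fun x1 x2 => x1 ≥ x2) (ae P) Y :=
    ⟨-C, by
      rw [Filter.eventually_map]
      exact Filter.Eventually.of_forall fun ω => (abs_le.1 (hC ω)).1⟩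
  have hFt0 : uβ ≤ cdfR P Y t0 := (quant_gc hY huβ t0).1 le_rfl
  have hat : a ≤ t0 := by
    by_contra! hlt
    have h1 : ∀ᵐ ω ∂P, a ≤ Y ω := ae_essInf_le hlow
    have h2 : P {ω | Y ω ≤ t0} = 0 := by
      rw [measure_eq_zero_iff_ae_notMem]
      filter_upwards [h1] with ω hω
      simp only [mem_setOf_eq, not_le]
      linarith
    have h3 : cdfR P Y t0 = 0 := by simp [cdfR, h2]
    linarith [huβ.1]
  set g : ℝ → ℝ := fun y => ∫ p in (cdfR P Y y)..1, σ p with hg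
  have hganti : Antitone g := fun x y hxy => hanti _ _ (hFm x) (hFm y) (cdfR_mono hxy)
  have hgC : ∀ y, C ≤ y → g y = 0 := by
    intro y hy
    have : cdfR P Y y = 1 := by
      have : {ω | Y ω ≤ y} = univ := by
        ext ω; simp only [mem_setOf_eq, mem_univ, iff_true]
        linarith [(abs_le.1 (hC ω)).2]
      simp [cdfR, this]
    simp [hg, this]
  have hgi : IntegrableOn g (Ioi t0) := by
    have hs : Ioi t0 ⊆ Icc t0 (max t0 C) ∪ Ioi (max t0 C) := by
      intro x hx
      rcases le_or_gt x (max t0 C) with h | h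
      · exact Or.inl ⟨le_of_lt hx, h⟩
      · exact Or.inr h
    refine IntegrableOn.mono_set ?_ hs
    refine ((hganti.antitoneOn _).integrableOn_isCompact isCompact_Icc).union ?_
    refine (integrableOn_congr_fun (g := fun _ => (0 : ℝ)) ?_ measurableSet_Ioi).2 integrableOn_zero
    intro x hx
    exact hgC x ((le_max_right _ _).trans (le_of_lt hx))
  have hA : EqOn (fun y => min 1 ((1 - β)⁻¹ * g y)) (fun _ => 1) (Ioo a t0) := by
    intro y hy
    have hlt : cdfR P Y y < uβ := by
      rw [← not_le, ← quant_gc hY huβ, not_le]; exact hy.2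
    have h := hanti _ _ (hFm y) hu' hlt.le
    rw [htail] at h
    refine min_eq_left ?_
    rw [inv_mul_eq_div, le_div_iff₀ hβ1, one_mul]
    exact h
  have hB : EqOn (fun y => min 1 ((1 - β)⁻¹ * g y)) (fun y => (1 - β)⁻¹ * g y) (Ioi t0) := by
    intro y hy
    have h := hanti _ _ hu' (hFm y) (hFt0.trans (cdfR_mono (le_of_lt hy)))
    rw [htail] at h
    refine min_eq_right ?_
    rw [inv_mul_eq_div, div_le_iff₀ hβ1, one_mul]
    exact h
  have hIA : IntegrableOn (fun y => min 1 ((1 - β)⁻¹ * g y)) (Ioc a t0) := by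
    rw [integrableOn_Ioc_iff_integrableOn_Ioo, integrableOn_congr_fun hA measurableSet_Ioo]
    exact integrableOn_const (by simp)
  have hIB : IntegrableOn (fun y => min 1 ((1 - β)⁻¹ * g y)) (Ioi t0) := by
    rw [integrableOn_congr_fun hB measurableSet_Ioi]
    exact hgi.const_mul _
  show t0 + (1 - β)⁻¹ * ∫ y in Ioi t0, g y = a + ∫ y in Ioi a, min 1 ((1 - β)⁻¹ * g y)
  rw [← Ioc_union_Ioi_eq_Ioi hat,
    setIntegral_union (Ioc_disjoint_Ioi le_rfl) measurableSet_Ioi hIA hIB,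
    integral_Ioc_eq_integral_Ioo, setIntegral_congr_fun measurableSet_Ioo hA,
    setIntegral_congr_fun measurableSet_Ioi hB, integral_const_mul]
  simp [hat]
  ring
end

section
/- Let α ∈ (1/2, 1) and let Z be an essentially bounded random variable. Then the dual norm of the expectile norm satisfies sup{ E[Y·Z] : Y ∈ L¹(P) and (1−α)·E[(1−|Y|)₊] ≥ α·E[(|Y|−1)₊] } = sup_{β ∈ (0,1)} [ (1−β)·AVaR_β(|Z|) + β·((1−α)/α)·‖Z‖_∞ ], where the constraint (1−α)·E[(1−|Y|)₊] ≥ α·E[(|Y|−1)₊] expresses that the expectile e_α(|Y|) is at most 1. -/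
open MeasureTheory Set

/-- Average value-at-risk `AVaR_α(Y) = (1-α)⁻¹ ∫_α^1 F_Y⁻¹(u) du`. -/
noncomputable def avarR {Ω : Type*} [MeasurableSpace Ω] (P : Measure Ω) (α : ℝ)
    (Y : Ω → ℝ) : ℝ :=
  (1 - α)⁻¹ * ∫ u in α..1, quantR P Y u

theorem quant_le_iff {Ω : Type*} [MeasurableSpace Ω] (P : Measure Ω) [IsProbabilityMeasure P]
    (W : Ω → ℝ) (hW : Measurable W) (h0 : ∀ ω, 0 ≤ W ω) (M : ℝ) (hM : ∀ᵐ ω ∂P, W ω ≤ M)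
    (u : ℝ) (hu : u ∈ Set.Ioc (0 : ℝ) 1) (x : ℝ) : quantR P W u ≤ x ↔ u ≤ cdfR P W x := by
  have : IsProbabilityMeasure (P.map W) := Measure.isProbabilityMeasure_map hW.aemeasurable
  have hF : ∀ y, cdfR P W y = ProbabilityTheory.cdf (P.map W) y := by
    intro y
    rw [ProbabilityTheory.cdf_eq_real, Measure.real, Measure.map_apply hW measurableSet_Iic]
    rfl
  have hbdd : BddBelow {x : ℝ | u ≤ cdfR P W x} := by
    refine ⟨0, fun y hy => ?_⟩
    by_contra! hlt
    have : {ω | W ω ≤ y} = ∅ := by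
      ext ω
      simp only [mem_ofPred_eq, mem_empty_iff_false, iff_false, not_le]
      exact lt_of_lt_of_le hlt (h0 ω)
    simp only [mem_ofPred_eq, cdfR, this, measure_empty, ENNReal.toReal_zero] at hy
    exact absurd hu.1 (not_lt.2 hy)
  have hne : {x : ℝ | u ≤ cdfR P W x}.Nonempty := by
    refine ⟨M, ?_⟩
    have : P {ω | W ω ≤ M} = 1 := by
      exact (prob_compl_eq_zero_iff (s := {ω | W ω ≤ M}) (hW measurableSet_Iic)).1 hM
    simp only [mem_ofPred_eq, cdfR, this, ENNReal.toReal_one]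
    exact hu.2
  constructor
  · intro h
    have key : ∀ y, x < y → u ≤ ProbabilityTheory.cdf (P.map W) y := by
      intro y hy
      obtain ⟨z, hz, hzy⟩ := exists_lt_of_csInf_lt hne (lt_of_le_of_lt h hy)
      have hz' : u ≤ cdfR P W z := hz
      rw [hF] at hz'
      exact hz'.trans ((ProbabilityTheory.monotone_cdf _) hzy.le)
    rw [hF]
    have hc := ((ProbabilityTheory.cdf (P.map W)).right_continuous x).mono Ioi_subset_Ici_self
    refine ge_of_tendsto hc.tendsto ?_
    filter_upwards [self_mem_nhdsWithin] with y hy using key y hy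
  · intro h
    exact csInf_le hbdd h

theorem quant_facts {Ω : Type*} [MeasurableSpace Ω] (P : Measure Ω) [IsProbabilityMeasure P]
    (W : Ω → ℝ) (hW : Measurable W) (h0 : ∀ ω, 0 ≤ W ω) (M : ℝ) (hM : ∀ᵐ ω ∂P, W ω ≤ M) :
    AEMeasurable (quantR P W) (volume.restrict (Ioc (0 : ℝ) 1)) ∧
    (volume.restrict (Ioc (0 : ℝ) 1)).map (quantR P W) = P.map W ∧
    IntervalIntegrable (quantR P W) volume 0 1 := by
  have hiff := quant_le_iff P W hW h0 M hM
  have hmeas : AEMeasurable (quantR P W) (volume.restrict (Ioc (0 : ℝ) 1)) := by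
    apply aemeasurable_restrict_of_monotoneOn measurableSet_Ioc
    intro a ha b hb hab
    rw [hiff a ha]
    exact hab.trans ((hiff b hb _).1 le_rfl)
  have hmap : (volume.restrict (Ioc (0 : ℝ) 1)).map (quantR P W) = P.map W := by
    have : IsProbabilityMeasure (P.map W) := Measure.isProbabilityMeasure_map hW.aemeasurable
    refine Measure.ext_of_Iic _ _ fun x => ?_
    rw [Measure.map_apply_of_aemeasurable hmeas measurableSet_Iic,
      Measure.map_apply hW measurableSet_Iic, Measure.restrict_apply' measurableSet_Ioc]
    have h1 : cdfR P W x ≤ 1 := by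
      unfold cdfR
      exact measureReal_le_one
    have : quantR P W ⁻¹' Iic x ∩ Ioc 0 1 = Ioc 0 (cdfR P W x) := by
      ext u
      simp only [mem_inter_iff, mem_preimage, mem_Iic, mem_Ioc]
      constructor
      · rintro ⟨h, hu⟩
        exact ⟨hu.1, (hiff u hu x).1 h⟩
      · rintro ⟨h, hu⟩
        exact ⟨(hiff u ⟨h, hu.trans h1⟩ x).2 hu, h, hu.trans h1⟩
    rw [this, Real.volume_Ioc, sub_zero, cdfR, ENNReal.ofReal_toReal (measure_ne_top _ _)]
    rfl
  refine ⟨hmeas, hmap, ?_⟩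
  rw [intervalIntegrable_iff_integrableOn_Ioc_of_le zero_le_one]
  have hi : Integrable (fun x : ℝ => x) (P.map W) := by
    rw [integrable_map_measure (by fun_prop) hW.aemeasurable]
    refine Integrable.of_bound hW.aestronglyMeasurable M ?_
    filter_upwards [hM] with ω h
    simpa [abs_of_nonneg (h0 ω)] using h
  rw [← hmap, integrable_map_measure (by fun_prop) hmeas] at hi
  exact hi

theorem rhs_lub {Ω : Type*} [MeasurableSpace Ω] (P : Measure Ω) [IsProbabilityMeasure P]
    (W : Ω → ℝ) (hW : Measurable W) (h0 : ∀ ω, 0 ≤ W ω) (M : ℝ) (hM : ∀ᵐ ω ∂P, W ω ≤ M)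
    (c : ℝ) :
    IsLUB ((fun β => (1 - β) * avarR P β W + β * c) '' Set.Ioo (0 : ℝ) 1)
      (∫ ω, max (W ω) c ∂P) := by
  obtain ⟨hmeas, hmap, hint⟩ := quant_facts P W hW h0 M hM
  have hiff := quant_le_iff P W hW h0 M hM
  have hG : ∫ ω, max (W ω) c ∂P = ∫ u in (0 : ℝ)..1, max (quantR P W u) c := by
    rw [intervalIntegral.integral_of_le zero_le_one,
      ← integral_map (f := fun x : ℝ => max x c) hW.aemeasurable (by fun_prop), ← hmap,
      integral_map hmeas (by fun_prop)]
  have hmaxint : IntervalIntegrable (fun u => max (quantR P W u) c) volume 0 1 := by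
    rw [intervalIntegrable_iff_integrableOn_Ioc_of_le zero_le_one] at hint ⊢
    exact hint.sup (integrable_const c)
  have sub : ∀ a b : ℝ, 0 ≤ a → a ≤ b → b ≤ 1 → uIcc a b ⊆ uIcc (0 : ℝ) 1 := by
    intro a b ha hab hb
    rw [uIcc_of_le hab, uIcc_of_le zero_le_one]
    exact Icc_subset_Icc ha hb
  have hsplit : ∀ β ∈ Icc (0 : ℝ) 1, ∫ u in (0 : ℝ)..1, max (quantR P W u) c =
      (∫ u in (0 : ℝ)..β, max (quantR P W u) c) + ∫ u in β..1, max (quantR P W u) c := by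
    intro β hβ
    rw [intervalIntegral.integral_add_adjacent_intervals]
    · exact hmaxint.mono_set (sub _ _ le_rfl hβ.1 hβ.2)
    · exact hmaxint.mono_set (sub _ _ hβ.1 hβ.2 le_rfl)
  set φ : ℝ → ℝ := fun β => (∫ u in β..1, quantR P W u) + β * c with hφ
  have himg : ((fun β => (1 - β) * avarR P β W + β * c) '' Set.Ioo (0 : ℝ) 1) =
      φ '' Ioo (0 : ℝ) 1 := by
    refine image_congr fun β hβ => ?_
    have : (1 - β) ≠ 0 := by linarith [hβ.2]
    simp only [hφ, avarR]
    field_simp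
  have hcont : ContinuousOn φ (Icc 0 1) := by
    have h1 : ContinuousOn (fun β => ∫ u in β..1, quantR P W u) (uIcc (0 : ℝ) 1) := by
      apply intervalIntegral.continuousOn_primitive_interval_left
      rw [uIcc_of_le zero_le_one, integrableOn_Icc_iff_integrableOn_Ioc]
      exact (intervalIntegrable_iff_integrableOn_Ioc_of_le zero_le_one).1 hint
    rw [uIcc_of_le zero_le_one] at h1
    exact h1.add (by fun_prop)
  rw [himg, hG]
  constructor
  · rintro _ ⟨β, hβ, rfl⟩
    rw [hsplit β ⟨hβ.1.le, hβ.2.le⟩]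
    have e1 : β * c ≤ ∫ u in (0 : ℝ)..β, max (quantR P W u) c := by
      have : β * c = ∫ u in (0 : ℝ)..β, c := by simp
      rw [this]
      refine intervalIntegral.integral_mono_on hβ.1.le (by simp)
        (hmaxint.mono_set (sub _ _ le_rfl hβ.1.le hβ.2.le)) fun u _ => le_max_right _ _
    have e2 : ∫ u in β..1, quantR P W u ≤ ∫ u in β..1, max (quantR P W u) c :=
      intervalIntegral.integral_mono_on hβ.2.le
        (hint.mono_set (sub _ _ hβ.1.le hβ.2.le le_rfl))
        (hmaxint.mono_set (sub _ _ hβ.1.le hβ.2.le le_rfl)) fun u _ => le_max_left _ _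
    simp only [hφ]
    linarith
  · intro s hs
    have hall : ∀ β ∈ Icc (0 : ℝ) 1, φ β ≤ s := by
      intro β hβ
      rw [← closure_Ioo zero_ne_one] at hβ hcont
      have := hcont.image_closure (mem_image_of_mem φ hβ)
      have h2 : closure (φ '' Ioo 0 1) ⊆ Iic s :=
        closure_minimal (fun y hy => hs hy) isClosed_Iic
      exact h2 this
    set b := cdfR P W c with hb
    have hb01 : b ∈ Icc (0 : ℝ) 1 := by
      refine ⟨ENNReal.toReal_nonneg, ?_⟩
      simp only [hb, cdfR]
      exact measureReal_le_one
    refine le_trans (le_of_eq ?_) (hall b hb01)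
    rw [hsplit b hb01]
    have e1 : ∫ u in (0 : ℝ)..b, max (quantR P W u) c = b * c := by
      have : b * c = ∫ u in (0 : ℝ)..b, c := by simp
      rw [this, intervalIntegral.integral_of_le hb01.1, intervalIntegral.integral_of_le hb01.1]
      refine setIntegral_congr_fun measurableSet_Ioc fun u hu => ?_
      exact max_eq_right ((hiff u ⟨hu.1, hu.2.trans hb01.2⟩ c).2 hu.2)
    have e2 : ∫ u in b..1, max (quantR P W u) c = ∫ u in b..1, quantR P W u := by
      rw [intervalIntegral.integral_of_le hb01.2, intervalIntegral.integral_of_le hb01.2]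
      refine setIntegral_congr_fun measurableSet_Ioc fun u hu => ?_
      refine max_eq_left ?_
      by_contra! h
      exact absurd ((hiff u ⟨hb01.1.trans_lt hu.1, hu.2⟩ c).1 h.le) (not_le.2 hu.1)
    rw [e1, e2, add_comm]

theorem lhs_upper {Ω : Type*} [MeasurableSpace Ω] (P : Measure Ω) [IsProbabilityMeasure P]
    (k : ℝ) (Z : Ω → ℝ) (hZ : Measurable Z) (M : ℝ) (hM0 : 0 ≤ M) (hM : ∀ᵐ ω ∂P, |Z ω| ≤ M)
    (Y : Ω → ℝ) (hY : Integrable Y P)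
    (hc : ∫ ω, max (|Y ω| - 1) 0 ∂P ≤ k * ∫ ω, max (1 - |Y ω|) 0 ∂P) :
    ∫ ω, Y ω * Z ω ∂P ≤ ∫ ω, max |Z ω| (k * M) ∂P := by
  have hZi : Integrable Z P := Integrable.of_bound hZ.aestronglyMeasurable M hM
  have hA : Integrable (fun ω => max (|Y ω| - 1) 0) P :=
    (hY.abs.sub (integrable_const 1)).sup (integrable_const 0)
  have hB : Integrable (fun ω => max (1 - |Y ω|) 0) P :=
    ((integrable_const 1).sub hY.abs).sup (integrable_const 0)
  have hYZ : Integrable (fun ω => Y ω * Z ω) P := hY.mul_bdd hZ.aestronglyMeasurable hM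
  have hmx : Integrable (fun ω => max |Z ω| (k * M)) P := hZi.abs.sup (integrable_const _)
  have key : ∫ ω, Y ω * Z ω ∂P ≤ ∫ ω, (max |Z ω| (k * M) +
      (M * max (|Y ω| - 1) 0 - (k * M) * max (1 - |Y ω|) 0)) ∂P := by
    refine integral_mono_ae hYZ (hmx.add ((hA.const_mul _).sub (hB.const_mul _))) ?_
    filter_upwards [hM] with ω h
    have h1 : Y ω * Z ω ≤ |Y ω| * |Z ω| := by rw [← abs_mul]; exact le_abs_self _
    have hy := abs_nonneg (Y ω)
    have hz := abs_nonneg (Z ω)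
    generalize |Y ω| = y at *
    generalize |Z ω| = z at *
    have m1 := le_max_left z (k * M)
    have m2 := le_max_right z (k * M)
    rcases le_total y 1 with h2 | h2
    · rw [max_eq_right (show y - 1 ≤ 0 by linarith), max_eq_left (show 0 ≤ 1 - y by linarith)]
      nlinarith [mul_le_mul_of_nonneg_left m1 hy, mul_le_mul_of_nonneg_left m2 (sub_nonneg.2 h2)]
    · rw [max_eq_left (show 0 ≤ y - 1 by linarith), max_eq_right (show 1 - y ≤ 0 by linarith)]
      nlinarith [mul_le_mul_of_nonneg_left h (sub_nonneg.2 h2)]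
  have hAB : Integrable (fun ω => M * max (|Y ω| - 1) 0 - (k * M) * max (1 - |Y ω|) 0) P :=
    (hA.const_mul _).sub (hB.const_mul _)
  rw [integral_add hmx hAB,
    integral_sub (hA.const_mul _) (hB.const_mul _), integral_const_mul, integral_const_mul] at key
  nlinarith [mul_le_mul_of_nonneg_left hc hM0]

theorem lhs_lower {Ω : Type*} [MeasurableSpace Ω] (P : Measure Ω) [IsProbabilityMeasure P]
    (k : ℝ) (hk0 : 0 ≤ k) (hk1 : k ≤ 1)
    (Z : Ω → ℝ) (hZ : Measurable Z) (M : ℝ) (hM : ∀ᵐ ω ∂P, |Z ω| ≤ M)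
    (d : ℝ) (hdM : d ≤ M) (hd : P {ω | d < |Z ω|} ≠ 0) :
    ∃ Y : Ω → ℝ, Integrable Y P ∧
      ∫ ω, max (|Y ω| - 1) 0 ∂P ≤ k * ∫ ω, max (1 - |Y ω|) 0 ∂P ∧
      ∫ ω, max |Z ω| (k * M) ∂P - (M - d) ≤ ∫ ω, Y ω * Z ω ∂P := by
  have hZi : Integrable Z P := Integrable.of_bound hZ.aestronglyMeasurable M hM
  set S := {ω | d < |Z ω|} with hS
  have hSm : MeasurableSet S := measurableSet_lt measurable_const hZ.abs
  set T := {ω | |Z ω| ≤ k * M} with hT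
  have hTm : MeasurableSet T := measurableSet_le hZ.abs measurable_const
  set p := P.real S with hp
  have hp0 : 0 < p := ENNReal.toReal_pos hd (measure_ne_top _ _)
  set b := P.real T with hb
  have hb0 : 0 ≤ b := measureReal_nonneg
  have hb1 : b ≤ 1 := measureReal_le_one
  set A : Ω → ℝ := S.indicator (fun _ => k * b / p) with hAdef
  set B : Ω → ℝ := T.indicator (fun _ => 1) with hBdef
  have hA0 : ∀ ω, 0 ≤ A ω := fun ω => indicator_nonneg (fun _ _ => by positivity) ω
  have hB0 : ∀ ω, 0 ≤ B ω := fun ω => indicator_nonneg (fun _ _ => zero_le_one) ω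
  have hB1 : ∀ ω, B ω ≤ 1 := fun ω => indicator_le_self' (fun _ _ => zero_le_one) ω
  have hAi : Integrable A P := (integrable_const _).indicator hSm
  have hBi : Integrable B P := (integrable_const _).indicator hTm
  have hAint : ∫ ω, A ω ∂P = k * b := by
    rw [hAdef, integral_indicator_const _ hSm, smul_eq_mul, ← hp]
    field_simp
  have hBint : ∫ ω, B ω ∂P = b := by
    rw [hBdef, integral_indicator_const _ hTm, smul_eq_mul, ← hb, mul_one]
  set σ : Ω → ℝ := fun ω => if 0 ≤ Z ω then 1 else -1 with hσ
  have hσm : Measurable σ :=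
    Measurable.ite (measurableSet_le measurable_const hZ) measurable_const measurable_const
  have hσabs : ∀ ω, |σ ω| = 1 := by
    intro ω; simp only [hσ]; split_ifs <;> simp
  have hσZ : ∀ ω, σ ω * Z ω = |Z ω| := by
    intro ω; simp only [hσ]; split_ifs with h
    · rw [abs_of_nonneg h, one_mul]
    · rw [abs_of_neg (not_le.1 h)]; ring
  have hYi : Integrable (fun ω => (1 + A ω - B ω) * σ ω) P := by
    refine (((integrable_const 1).add hAi).sub hBi).mul_bdd (c := 1) hσm.aestronglyMeasurable ?_
    exact Filter.Eventually.of_forall fun ω => (hσabs ω).le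
  have hYabs : ∀ ω, |(1 + A ω - B ω) * σ ω| = 1 + A ω - B ω := by
    intro ω
    rw [abs_mul, hσabs, mul_one, abs_of_nonneg]
    linarith [hA0 ω, hB1 ω]
  refine ⟨fun ω => (1 + A ω - B ω) * σ ω, hYi, ?_, ?_⟩
  · have i1 : Integrable (fun ω => max (1 + A ω - B ω - 1) 0) P :=
      ((((integrable_const 1).add hAi).sub hBi).sub (integrable_const 1)).sup (integrable_const 0)
    have i2 : Integrable (fun ω => max (1 - (1 + A ω - B ω)) 0) P :=
      ((integrable_const 1).sub (((integrable_const 1).add hAi).sub hBi)).sup (integrable_const 0)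
    simp only [hYabs]
    have : ∫ ω, (max (1 + A ω - B ω - 1) 0 - k * max (1 - (1 + A ω - B ω)) 0) ∂P ≤
        ∫ ω, (A ω - k * B ω) ∂P := by
      refine integral_mono (i1.sub (i2.const_mul k)) (hAi.sub (hBi.const_mul k)) fun ω => ?_
      have ha := hA0 ω
      have hb := hB0 ω
      simp only
      rcases le_total (A ω) (B ω) with h | h
      · rw [max_eq_right (by linarith), max_eq_left (by linarith)]
        nlinarith
      · rw [max_eq_left (by linarith), max_eq_right (by linarith)]
        nlinarith
    rw [integral_sub i1 (i2.const_mul k), integral_sub hAi (hBi.const_mul k), integral_const_mul,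
      integral_const_mul, hAint, hBint] at this
    linarith
  · have hmx : Integrable (fun ω => max |Z ω| (k * M)) P := hZi.abs.sup (integrable_const _)
    have key : ∫ ω, (max |Z ω| (k * M) + (d * A ω - (k * M) * B ω)) ∂P ≤
        ∫ ω, (1 + A ω - B ω) * σ ω * Z ω ∂P := by
      refine integral_mono (hmx.add ((hAi.const_mul _).sub (hBi.const_mul _)))
        (hYi.mul_bdd hZ.aestronglyMeasurable hM) fun ω => ?_
      simp only
      rw [mul_assoc _ (σ ω), hσZ]
      have e1 : d * A ω ≤ |Z ω| * A ω := by
        by_cases h : ω ∈ S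
        · exact mul_le_mul_of_nonneg_right (le_of_lt h) (hA0 ω)
        · simp [hAdef, h]
      have e2 : max |Z ω| (k * M) = |Z ω| + B ω * (k * M - |Z ω|) := by
        by_cases h : ω ∈ T
        · have h' : |Z ω| ≤ k * M := h
          rw [max_eq_right h']
          simp [hBdef, h]
        · have h' : ¬ |Z ω| ≤ k * M := h
          rw [max_eq_left (not_le.1 h').le]
          simp [hBdef, h]
      rw [e2]
      linarith
    have hAB : Integrable (fun ω => d * A ω - (k * M) * B ω) P :=
      (hAi.const_mul _).sub (hBi.const_mul _)
    rw [integral_add hmx hAB,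
      integral_sub (hAi.const_mul _) (hBi.const_mul _), integral_const_mul, integral_const_mul,
      hAint, hBint] at key
    have hkb : k * b ≤ 1 := mul_le_one₀ hk1 hb0 hb1
    nlinarith [mul_le_mul_of_nonneg_right hkb (sub_nonneg.2 hdM)]

theorem stmt18 {Ω : Type*} [MeasurableSpace Ω] (P : Measure Ω) [IsProbabilityMeasure P]
    (α : ℝ) (hα : α ∈ Set.Ioo (1 / 2 : ℝ) 1)
    (Z : Ω → ℝ) (hZmeas : Measurable Z)
    (hZbdd : ∃ C : ℝ, ∀ᵐ ω ∂P, |Z ω| ≤ C) :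
    sSup {r : ℝ | ∃ Y : Ω → ℝ, Integrable Y P ∧
        α * ∫ ω, max (|Y ω| - 1) 0 ∂P ≤ (1 - α) * ∫ ω, max (1 - |Y ω|) 0 ∂P ∧
        r = ∫ ω, Y ω * Z ω ∂P} =
    sSup ((fun β => (1 - β) * avarR P β (fun ω => |Z ω|) +
        β * ((1 - α) / α) * essSup (fun ω => |Z ω|) P) '' Set.Ioo (0 : ℝ) 1) := by
  obtain ⟨C, hC⟩ := hZbdd
  obtain ⟨ha1, ha2⟩ := hα
  have hα0 : 0 < α := by linarith
  set M := essSup (fun ω => |Z ω|) P with hMdef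
  have hbu : Filter.IsBoundedUnder (· ≤ ·) (ae P) (fun ω => |Z ω|) := ⟨C, by simpa using hC⟩
  have hM : ∀ᵐ ω ∂P, |Z ω| ≤ M := ae_le_essSup hbu
  have hM0 : 0 ≤ M := by
    obtain ⟨ω, h⟩ := hM.exists
    exact (abs_nonneg _).trans h
  have hd : ∀ d < M, P {ω | d < |Z ω|} ≠ 0 := by
    intro d hd h
    have h1 : ∀ᵐ ω ∂P, |Z ω| ≤ d := by
      rw [ae_iff]
      simpa using h
    have : M ≤ d := by
      have hco : Filter.IsCoboundedUnder (· ≤ ·) (ae P) (fun ω => |Z ω|) :=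
        Filter.IsBoundedUnder.isCoboundedUnder_le
          ⟨0, by simp⟩
      exact Filter.limsup_le_of_le hco h1
    linarith
  set k := (1 - α) / α with hk
  have hk0 : 0 ≤ k := div_nonneg (by linarith) hα0.le
  have hk1 : k ≤ 1 := by
    rw [hk, div_le_one hα0]; linarith
  have hαk : 1 - α = α * k := by rw [hk]; field_simp
  have hR := rhs_lub P (fun ω => |Z ω|) hZmeas.abs (fun ω => abs_nonneg _) M hM (k * M)
  have hR' : sSup ((fun β => (1 - β) * avarR P β (fun ω => |Z ω|) +
        β * k * M) '' Set.Ioo (0 : ℝ) 1) = ∫ ω, max |Z ω| (k * M) ∂P := by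
    simp only [mul_assoc _ k M]
    exact hR.csSup_eq ((nonempty_Ioo.2 zero_lt_one).image _)
  rw [hR']
  have hcon : ∀ Y : Ω → ℝ,
      (α * ∫ ω, max (|Y ω| - 1) 0 ∂P ≤ (1 - α) * ∫ ω, max (1 - |Y ω|) 0 ∂P) ↔
      ∫ ω, max (|Y ω| - 1) 0 ∂P ≤ k * ∫ ω, max (1 - |Y ω|) 0 ∂P := by
    intro Y
    rw [hαk, mul_assoc]
    exact mul_le_mul_iff_right₀ hα0
  simp only [hcon]
  refine csSup_eq_of_forall_le_of_forall_lt_exists_gt ?_ ?_ ?_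
  · obtain ⟨Y, h1, h2, -⟩ := lhs_lower P k hk0 hk1 Z hZmeas M hM (M - 1) (by linarith)
      (hd _ (by linarith))
    exact ⟨_, Y, h1, h2, rfl⟩
  · rintro r ⟨Y, h1, h2, rfl⟩
    exact lhs_upper P k Z hZmeas M hM0 hM Y h1 h2
  · intro w hw
    set G := ∫ ω, max |Z ω| (k * M) ∂P with hG
    obtain ⟨Y, h1, h2, h3⟩ := lhs_lower P k hk0 hk1 Z hZmeas M hM (M - (G - w) / 2) (by linarith)
      (hd _ (by linarith))
    exact ⟨_, ⟨Y, h1, h2, rfl⟩, by linarith⟩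
end
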